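/- Fix an integer K ≥ 0 and define s_n = Σ_{0 ≤ r ≤ K} ℙ(E_r^{(n)}) for n ≥ 1, where E_r^{(n)} are the row-growth events of the Plancherel growth process. Then liminf_{n→∞} (s_1 + ⋯ + s_n)/√n ≥ 2(K+1). -/

import Mathlib

open MeasureTheory Filter

/-- The number of standard Young tableaux of shape `μ`: bijective fillings of the cells of `μ`
by `0, 1, …, μ.card - 1` that are strictly increasing along rows and columns. -/
noncomputable def sytCount (μ : YoungDiagram) : ℕ :=
  Nat.card {T : μ.cells → Fin μ.card //
    Function.Bijective T ∧
      ∀ a b : μ.cells, (a : ℕ × ℕ).1 ≤ (b : ℕ × ℕ).1 → (a : ℕ × ℕ).2 ≤ (b : ℕ × ℕ).2 →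
        a ≠ b → T a < T b}

/-- `lam 0 ↗ lam 1 ↗ ⋯` is a Plancherel growth process: the probability of any prescribed
initial path `∅ = μ⁽⁰⁾ ↗ μ⁽¹⁾ ↗ ⋯ ↗ μ⁽ⁿ⁾` in the Young graph equals `d_{μ⁽ⁿ⁾} / n!`,
which characterizes the distribution of the sequence of RSK shapes of an i.i.d. uniform
sequence. -/
def IsPlancherelGrowthProcess {Ω : Type*} [MeasurableSpace Ω] (P : Measure Ω)
    (lam : ℕ → Ω → YoungDiagram) : Prop :=
  IsProbabilityMeasure P ∧
  (∀ (n : ℕ) (y : YoungDiagram), MeasurableSet {ω | lam n ω = y}) ∧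
  ∀ (n : ℕ) (path : ℕ → YoungDiagram), path 0 = ⊥ →
    (∀ i, i < n → path i ≤ path (i + 1) ∧ (path (i + 1)).card = (path i).card + 1) →
    P {ω | ∀ i ≤ n, lam i ω = path i} =
      (sytCount (path n) : ENNReal) / (Nat.factorial n : ENNReal)

/-- The event `E_r⁽ⁿ⁺¹⁾` that the box added in step `n+1` of the growth process
(i.e. the unique box of `λ⁽ⁿ⁺¹⁾ ∖ λ⁽ⁿ⁾`) lies in the row with index `r`. -/
def growthEvent {Ω : Type*} (lam : ℕ → Ω → YoungDiagram) (n r : ℕ) : Set Ω :=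
  {ω | (lam (n + 1) ω).rowLen r = (lam n ω).rowLen r + 1}

section PlancherelProof

open Finset


theorem finite_level (n : ℕ) : Set.Finite {μ : YoungDiagram | μ.card = n} := by
  have hinj : Function.Injective (fun μ : YoungDiagram => μ.cells) := by
    intro a b h
    exact YoungDiagram.ext h
  refine Set.Finite.of_finite_image (f := fun μ : YoungDiagram => μ.cells) ?_ hinj.injOn
  refine Set.Finite.subset (Finset.finite_toSet ((range n ×ˢ range n).powerset)) ?_
  rintro _ ⟨μ, hμ, rfl⟩
  have hμ : μ.cells.card = n := hμ
  simp only [coe_powerset, Set.mem_preimage, Set.mem_powerset_iff, coe_subset]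
  rintro ⟨i, j⟩ hc
  rw [YoungDiagram.mem_cells] at hc
  simp only [mem_product, mem_range]
  constructor
  · have h1 : (range (i+1)).image (fun a => (a, j)) ⊆ μ.cells := by
      intro x hx
      simp only [mem_image, mem_range] at hx
      obtain ⟨a, ha, rfl⟩ := hx
      exact μ.up_left_mem (by omega) le_rfl hc
    have h2 := card_le_card h1
    rw [card_image_of_injective _ (fun a b h => by simpa using h)] at h2
    simp at h2
    omega
  · have h1 : (range (j+1)).image (fun a => (i, a)) ⊆ μ.cells := by
      intro x hx
      simp only [mem_image, mem_range] at hx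
      obtain ⟨a, ha, rfl⟩ := hx
      exact μ.up_left_mem le_rfl (by omega) hc
    have h2 := card_le_card h1
    rw [card_image_of_injective _ (fun a b h => by simpa using h)] at h2
    simp at h2
    omega

noncomputable def lev (n : ℕ) : Finset YoungDiagram := (finite_level n).toFinset

theorem mem_lev {n : ℕ} {μ : YoungDiagram} : μ ∈ lev n ↔ μ.card = n := by
  simp [lev]

open Classical in
noncomputable def ups (μ : YoungDiagram) : Finset YoungDiagram :=
  (lev (μ.card + 1)).filter (fun Λ => μ ≤ Λ)

open Classical in
noncomputable def dns (Λ : YoungDiagram) : Finset YoungDiagram :=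
  (lev (Λ.card - 1)).filter (fun μ => μ ≤ Λ ∧ Λ.card = μ.card + 1)

theorem mem_ups {μ Λ : YoungDiagram} : Λ ∈ ups μ ↔ μ ≤ Λ ∧ Λ.card = μ.card + 1 := by
  simp only [ups, mem_filter, mem_lev]; tauto

theorem mem_dns {μ Λ : YoungDiagram} : μ ∈ dns Λ ↔ μ ≤ Λ ∧ Λ.card = μ.card + 1 := by
  simp only [dns, mem_filter, mem_lev]
  constructor
  · tauto
  · intro h; exact ⟨by omega, h⟩

/-- total content -/
noncomputable def cont (μ : YoungDiagram) : ℝ := ∑ c ∈ μ.cells, ((c.2 : ℝ) - (c.1 : ℝ))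

noncomputable def wt (t : ℝ) (μ Λ : YoungDiagram) : ℝ := Real.exp (t * (cont Λ - cont μ))

theorem edge_row {μ Λ : YoungDiagram} (h : Λ ∈ ups μ) :
    ∃ i, Λ.cells = insert (i, μ.rowLen i) μ.cells := by
  rw [mem_ups] at h
  obtain ⟨hle, hc⟩ := h
  have hsub : μ.cells ⊆ Λ.cells := YoungDiagram.cells_subset_iff.2 hle
  have h1 : (Λ.cells \ μ.cells).card = 1 := by
    rw [card_sdiff_of_subset hsub]; simp only [YoungDiagram.card] at hc; omega
  rw [card_eq_one] at h1
  obtain ⟨⟨i, j⟩, hij⟩ := h1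
  have hΛ : Λ.cells = insert (i, j) μ.cells := by
    rw [← sdiff_union_of_subset hsub, hij]; rfl
  have hmem : (i, j) ∈ Λ.cells \ μ.cells := by rw [hij]; simp
  rw [Finset.mem_sdiff, YoungDiagram.mem_cells, YoungDiagram.mem_cells] at hmem
  have hj : μ.rowLen i ≤ j := by
    by_contra hlt
    exact hmem.2 (YoungDiagram.mem_iff_lt_rowLen.2 (by omega))
  have h2 : (i, μ.rowLen i) ∈ Λ.cells := Λ.up_left_mem le_rfl hj hmem.1
  rw [hΛ, mem_insert] at h2
  rcases h2 with h2 | h2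
  · refine ⟨i, ?_⟩
    rw [hΛ, h2]
  · rw [YoungDiagram.mem_cells, YoungDiagram.mem_iff_lt_rowLen] at h2
    omega

theorem notMem_rowLen (μ : YoungDiagram) (i : ℕ) : (i, μ.rowLen i) ∉ μ.cells := by
  rw [YoungDiagram.mem_cells, YoungDiagram.mem_iff_lt_rowLen]; omega

theorem rowLen_insert {μ Λ : YoungDiagram} {i : ℕ} (h : Λ.cells = insert (i, μ.rowLen i) μ.cells)
    (r : ℕ) : Λ.rowLen r = μ.rowLen r + if r = i then 1 else 0 := by
  have key : ∀ j, j < Λ.rowLen r ↔ j < μ.rowLen r + if r = i then 1 else 0 := by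
    intro j
    rw [← YoungDiagram.mem_iff_lt_rowLen, ← YoungDiagram.mem_cells, h, mem_insert,
      YoungDiagram.mem_cells, YoungDiagram.mem_iff_lt_rowLen, Prod.mk.injEq]
    split_ifs with hr
    · subst hr; omega
    · simp [hr]
  apply le_antisymm
  · by_contra hlt
    have := (key (μ.rowLen r + if r = i then 1 else 0)).1 (by omega)
    omega
  · by_contra hlt
    have := (key (Λ.rowLen r)).2 (by omega)
    omega

theorem cells_sum_edge {μ Λ : YoungDiagram} {i : ℕ}
    (h : Λ.cells = insert (i, μ.rowLen i) μ.cells) (f : ℕ × ℕ → ℝ) :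
    ∑ c ∈ Λ.cells, f c = ∑ c ∈ μ.cells, f c + f (i, μ.rowLen i) := by
  rw [h, sum_insert (notMem_rowLen μ i), add_comm]

theorem cont_edge {μ Λ : YoungDiagram} {i : ℕ}
    (h : Λ.cells = insert (i, μ.rowLen i) μ.cells) :
    cont Λ - cont μ = (μ.rowLen i : ℝ) - i := by
  unfold cont
  rw [cells_sum_edge h]; ring

noncomputable def qq (t : ℝ) (μ : YoungDiagram) : ℝ :=
  ∑ Λ ∈ ups μ, wt t μ Λ - ∑ ν ∈ dns μ, wt t ν μ

theorem cont_modular (μ ν : YoungDiagram) : cont (μ ⊔ ν) + cont (μ ⊓ ν) = cont μ + cont ν := by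
  unfold cont
  rw [YoungDiagram.cells_sup, YoungDiagram.cells_inf, sum_union_inter]

theorem card_modular (μ ν : YoungDiagram) :
    (μ ⊔ ν).card + (μ ⊓ ν).card = μ.card + ν.card := by
  simp only [YoungDiagram.card, YoungDiagram.cells_sup, YoungDiagram.cells_inf,
    card_union_add_card_inter]

theorem eq_of_le_card {μ ν : YoungDiagram} (h : μ ≤ ν) (hc : ν.card ≤ μ.card) : μ = ν :=
  YoungDiagram.ext (eq_of_subset_of_card_le (YoungDiagram.cells_subset_iff.2 h) hc)

theorem yd_card_mono {μ ν : YoungDiagram} (h : μ ≤ ν) : μ.card ≤ ν.card :=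
  card_le_card (YoungDiagram.cells_subset_iff.2 h)

open Classical in
theorem commutation (t : ℝ) {n : ℕ} {μ ν : YoungDiagram} (hμ : μ ∈ lev n) (hν : ν ∈ lev n) :
    ∑ Λ ∈ ups μ ∩ ups ν, wt t μ Λ =
      (if μ = ν then qq t μ else 0) + ∑ κ ∈ dns μ ∩ dns ν, wt t κ ν := by
  rw [mem_lev] at hμ hν
  split_ifs with h
  · subst h
    simp [qq]
  · have hmod := card_modular μ ν
    have hcm := cont_modular μ ν
    have hinf : (μ ⊓ ν).card < n := by
      by_contra hge
      have h1 : μ ⊓ ν = μ := eq_of_le_card inf_le_left (by omega)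
      have h2 : μ ⊓ ν = ν := eq_of_le_card inf_le_right (by omega)
      exact h (h1.symm.trans h2)
    have hU : ∀ Λ, Λ ∈ ups μ ∩ ups ν → Λ = μ ⊔ ν ∧ (μ ⊔ ν).card = n + 1 := by
      intro Λ hΛ
      rw [mem_inter, mem_ups, mem_ups] at hΛ
      have hle : μ ⊔ ν ≤ Λ := sup_le hΛ.1.1 hΛ.2.1
      have := yd_card_mono hle
      have h3 := eq_of_le_card hle (by omega)
      exact ⟨h3.symm, by omega⟩
    have hD : ∀ κ, κ ∈ dns μ ∩ dns ν → κ = μ ⊓ ν ∧ (μ ⊓ ν).card + 1 = n := by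
      intro Λ hΛ
      rw [mem_inter, mem_dns, mem_dns] at hΛ
      have hle : Λ ≤ μ ⊓ ν := le_inf hΛ.1.1 hΛ.2.1
      have := yd_card_mono hle
      have h3 := eq_of_le_card hle (by omega)
      exact ⟨h3, by omega⟩
    by_cases hc : (μ ⊔ ν).card = n + 1
    · have e1 : ups μ ∩ ups ν = {μ ⊔ ν} := by
        ext Λ
        rw [mem_singleton]
        refine ⟨fun h => (hU Λ h).1, ?_⟩
        rintro rfl
        rw [mem_inter, mem_ups, mem_ups]
        exact ⟨⟨le_sup_left, by omega⟩, ⟨le_sup_right, by omega⟩⟩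
      have e2 : dns μ ∩ dns ν = {μ ⊓ ν} := by
        ext Λ
        rw [mem_singleton]
        refine ⟨fun h => (hD Λ h).1, ?_⟩
        rintro rfl
        rw [mem_inter, mem_dns, mem_dns]
        exact ⟨⟨inf_le_left, by omega⟩, ⟨inf_le_right, by omega⟩⟩
      rw [e1, e2, sum_singleton, sum_singleton, zero_add]
      unfold wt
      congr 2
      linarith
    · have e1 : ups μ ∩ ups ν = ∅ := by
        rw [eq_empty_iff_forall_notMem]
        intro Λ h
        exact hc (hU Λ h).2
      have e2 : dns μ ∩ dns ν = ∅ := by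
        rw [eq_empty_iff_forall_notMem]
        intro Λ h
        have := (hD Λ h).2
        omega
      rw [e1, e2]; simp

/-- adding a box -/
theorem exists_add (μ : YoungDiagram) (i : ℕ) (h : i = 0 ∨ μ.rowLen i < μ.rowLen (i - 1)) :
    ∃ Λ ∈ ups μ, Λ.cells = insert (i, μ.rowLen i) μ.cells := by
  have hlow : IsLowerSet ((insert (i, μ.rowLen i) μ.cells : Finset (ℕ × ℕ)) : Set (ℕ × ℕ)) := by
    rintro ⟨a, b⟩ ⟨a', b'⟩ hle hmem
    simp only [Prod.mk_le_mk] at hle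
    rw [mem_coe, mem_insert] at hmem ⊢
    rcases hmem with hmem | hmem
    · simp only [Prod.mk.injEq] at hmem ⊢
      obtain ⟨rfl, rfl⟩ := hmem
      rw [YoungDiagram.mem_cells, YoungDiagram.mem_iff_lt_rowLen]
      by_cases ha : a' = a
      · subst ha; omega
      · right
        rcases h with h | h
        · omega
        · have := μ.rowLen_anti a' (a - 1) (by omega)
          omega
    · right
      exact μ.up_left_mem hle.1 hle.2 hmem
  refine ⟨⟨_, hlow⟩, ?_, rfl⟩
  rw [mem_ups]
  refine ⟨YoungDiagram.cells_subset_iff.1 (subset_insert _ _), ?_⟩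
  exact card_insert_of_notMem (notMem_rowLen μ i)

theorem addable_of_edge {μ Λ : YoungDiagram} {i : ℕ}
    (h : Λ.cells = insert (i, μ.rowLen i) μ.cells) :
    i = 0 ∨ μ.rowLen i < μ.rowLen (i - 1) := by
  by_cases hi : i = 0
  · exact Or.inl hi
  · right
    have h1 := rowLen_insert h i
    have h2 := rowLen_insert h (i - 1)
    have h3 := Λ.rowLen_anti (i - 1) i (by omega)
    rw [if_pos rfl] at h1
    rw [if_neg (by omega)] at h2
    omega

theorem exists_rem (μ : YoungDiagram) (i : ℕ) (h : μ.rowLen (i + 1) < μ.rowLen i) :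
    ∃ ν ∈ dns μ, μ.cells = insert (i, ν.rowLen i) ν.cells ∧ ν.rowLen i + 1 = μ.rowLen i := by
  have hlow : IsLowerSet ((μ.cells.erase (i, μ.rowLen i - 1) : Finset (ℕ × ℕ)) : Set (ℕ × ℕ)) := by
    rintro ⟨a, b⟩ ⟨a', b'⟩ hle hmem
    simp only [Prod.mk_le_mk] at hle
    rw [mem_coe, mem_erase] at hmem ⊢
    refine ⟨?_, μ.up_left_mem hle.1 hle.2 hmem.2⟩
    intro heq
    simp only [Prod.mk.injEq] at heq
    obtain ⟨rfl, rfl⟩ := heq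
    have h2 := hmem.2
    rw [YoungDiagram.mem_cells, YoungDiagram.mem_iff_lt_rowLen] at h2
    have h1 := hmem.1
    simp only [ne_eq, Prod.mk.injEq, not_and] at h1
    by_cases ha : a = a'
    · subst ha; omega
    · have := μ.rowLen_anti (a' + 1) a (by omega)
      omega
  have hin : (i, μ.rowLen i - 1) ∈ μ.cells := by
    rw [YoungDiagram.mem_cells, YoungDiagram.mem_iff_lt_rowLen]; omega
  have hd : (⟨_, hlow⟩ : YoungDiagram) ∈ dns μ := by
    rw [mem_dns]
    refine ⟨YoungDiagram.cells_subset_iff.1 (erase_subset _ _), ?_⟩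
    exact (card_erase_add_one hin).symm
  refine ⟨⟨_, hlow⟩, hd, ?_⟩
  have hu : μ ∈ ups (⟨_, hlow⟩ : YoungDiagram) := by
    rw [mem_ups]; exact mem_dns.1 hd
  obtain ⟨i', hi'⟩ := edge_row hu
  have h1 : (i, μ.rowLen i - 1) ∈ insert (i', (⟨_, hlow⟩ : YoungDiagram).rowLen i') (μ.cells.erase (i, μ.rowLen i - 1)) := by
    rw [← hi']; exact hin
  simp only [mem_insert, Prod.mk.injEq, mem_erase, ne_eq, not_true_eq_false, false_and, or_false] at h1
  obtain ⟨rfl, h1⟩ := h1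
  refine ⟨hi', ?_⟩
  rw [← h1]; omega

theorem removable_of_edge {μ ν : YoungDiagram} {i : ℕ}
    (h : μ.cells = insert (i, ν.rowLen i) ν.cells) :
    μ.rowLen (i + 1) < μ.rowLen i ∧ μ.rowLen i = ν.rowLen i + 1 := by
  have h1 := rowLen_insert h i
  have h2 := rowLen_insert h (i + 1)
  have h3 := ν.rowLen_anti i (i + 1) (by omega)
  rw [if_pos rfl] at h1
  rw [if_neg (by omega)] at h2
  omega

theorem rowLen_zero_of_card_le (μ : YoungDiagram) {i : ℕ} (h : μ.card ≤ i) : μ.rowLen i = 0 := by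
  by_contra hne
  have h1 : (range (i+1)).image (fun a => (a, 0)) ⊆ μ.cells := by
    intro x hx
    simp only [mem_image, mem_range] at hx
    obtain ⟨a, ha, rfl⟩ := hx
    rw [YoungDiagram.mem_cells, YoungDiagram.mem_iff_lt_rowLen]
    have := μ.rowLen_anti a i (by omega)
    omega
  have h2 := card_le_card h1
  rw [card_image_of_injective _ (fun a b h => by simpa using h)] at h2
  simp at h2
  simp only [YoungDiagram.card] at h
  omega

theorem sum_ups (t : ℝ) (μ : YoungDiagram) :
    ∑ Λ ∈ ups μ, wt t μ Λ = ∑ i ∈ (range (μ.card + 1)).filter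
      (fun i => i = 0 ∨ μ.rowLen i < μ.rowLen (i - 1)),
      Real.exp (t * ((μ.rowLen i : ℝ) - i)) := by
  symm
  choose! g hg1 hg2 using (exists_add μ)
  refine sum_bij (fun i _ => g i) ?_ ?_ ?_ ?_
  · intro i hi
    exact hg1 i (mem_filter.1 hi).2
  · intro i hi j hj hij
    have h1 := hg2 i (mem_filter.1 hi).2
    have h2 := hg2 j (mem_filter.1 hj).2
    rw [hij] at h1
    have h3 := rowLen_insert h1 i
    have h4 := rowLen_insert h2 i
    by_contra hne
    rw [if_pos rfl] at h3
    rw [if_neg hne] at h4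
    omega
  · intro Λ hΛ
    obtain ⟨i, hi⟩ := edge_row hΛ
    have ha := addable_of_edge hi
    refine ⟨i, ?_, ?_⟩
    · rw [mem_filter, mem_range]
      refine ⟨?_, ha⟩
      by_contra hlt
      rcases ha with ha | ha
      · omega
      · have := rowLen_zero_of_card_le μ (i := i - 1) (by omega)
        omega
    · exact YoungDiagram.ext ((hg2 i ha).trans hi.symm)
  · intro i hi
    unfold wt
    rw [cont_edge (hg2 i (mem_filter.1 hi).2)]

theorem sum_dns (t : ℝ) (μ : YoungDiagram) :
    ∑ ν ∈ dns μ, wt t ν μ = ∑ i ∈ (range μ.card).filter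
      (fun i => μ.rowLen (i + 1) < μ.rowLen i),
      Real.exp (t * ((μ.rowLen i : ℝ) - 1 - i)) := by
  symm
  choose! g hg1 hg2 hg3 using (exists_rem μ)
  refine sum_bij (fun i _ => g i) ?_ ?_ ?_ ?_
  · intro i hi
    exact hg1 i (mem_filter.1 hi).2
  · intro i hi j hj hij
    have h1 := hg2 i (mem_filter.1 hi).2
    have h2 := hg2 j (mem_filter.1 hj).2
    rw [hij] at h1
    have h3 := rowLen_insert h1 i
    have h4 := rowLen_insert h2 i
    by_contra hne
    rw [if_pos rfl] at h3
    rw [if_neg hne] at h4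
    omega
  · intro ν hν
    obtain ⟨i, hi⟩ := edge_row (mem_ups.2 (mem_dns.1 hν))
    obtain ⟨hr, hr'⟩ := removable_of_edge hi
    refine ⟨i, ?_, ?_⟩
    · rw [mem_filter, mem_range]
      refine ⟨?_, hr⟩
      by_contra hlt
      have := rowLen_zero_of_card_le μ (i := i) (by omega)
      omega
    · have e1 := hg2 i hr
      have e2 := hg3 i hr
      have e3 : (g i).rowLen i = ν.rowLen i := by omega
      apply YoungDiagram.ext
      have n1 := notMem_rowLen (g i) i
      have n2 := notMem_rowLen ν i
      rw [← erase_insert n1, ← erase_insert n2, ← e1, ← hi, e3]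
  · intro i hi
    unfold wt
    rw [cont_edge (hg2 i (mem_filter.1 hi).2), ← hg3 i (mem_filter.1 hi).2]
    push_cast
    congr 2
    ring

theorem cells_sum_rows (μ : YoungDiagram) (f : ℕ × ℕ → ℝ) :
    ∑ c ∈ μ.cells, f c = ∑ i ∈ range μ.card, ∑ j ∈ range (μ.rowLen i), f (i, j) := by
  rw [sum_sigma']
  symm
  refine sum_bij (fun p _ => (p.1, p.2)) ?_ ?_ ?_ ?_
  · rintro ⟨i, j⟩ h
    simp only [mem_sigma, mem_range] at h
    rw [YoungDiagram.mem_cells, YoungDiagram.mem_iff_lt_rowLen]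
    exact h.2
  · rintro ⟨i, j⟩ h ⟨i', j'⟩ h' heq
    simp only [Prod.mk.injEq] at heq
    obtain ⟨rfl, rfl⟩ := heq
    rfl
  · rintro ⟨i, j⟩ h
    rw [YoungDiagram.mem_cells, YoungDiagram.mem_iff_lt_rowLen] at h
    refine ⟨⟨i, j⟩, ?_, rfl⟩
    simp only [mem_sigma, mem_range]
    refine ⟨?_, h⟩
    by_contra hlt
    have := rowLen_zero_of_card_le μ (i := i) (by omega)
    omega
  · rintro ⟨i, j⟩ h
    rfl

noncomputable def ss (t : ℝ) : ℝ := Real.exp t + Real.exp (-t) - 2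

noncomputable def SS (t : ℝ) (μ : YoungDiagram) : ℝ :=
  ∑ c ∈ μ.cells, Real.exp (t * ((c.2 : ℝ) - c.1))

theorem row_geom (t : ℝ) (i l : ℕ) :
    ss t * ∑ j ∈ range l, Real.exp (t * ((j : ℝ) - i)) =
      (Real.exp (t * ((l : ℝ) - i)) - Real.exp (t * ((l : ℝ) - 1 - i)))
        + Real.exp (-t * (i + 1)) - Real.exp (-t * i) := by
  induction l with
  | zero =>
    simp only [range_zero, sum_empty, mul_zero, Nat.cast_zero]
    rw [show t * ((0:ℝ) - i) = -t * i by ring, show t * ((0:ℝ) - 1 - i) = -t * (i + 1) by ring]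
    ring
  | succ l ih =>
    rw [sum_range_succ, mul_add, ih]
    have h1 : Real.exp (t * (((l + 1 : ℕ) : ℝ) - i)) = Real.exp t * Real.exp (t * ((l : ℝ) - i)) := by
      rw [← Real.exp_add]; congr 1; push_cast; ring
    have h2 : Real.exp (t * (((l + 1 : ℕ) : ℝ) - 1 - i)) = Real.exp (t * ((l : ℝ) - i)) := by
      congr 1; push_cast; ring
    have h3 : Real.exp (t * ((l : ℝ) - 1 - i)) = Real.exp (-t) * Real.exp (t * ((l : ℝ) - i)) := by
      rw [← Real.exp_add]; congr 1; ring
    rw [h1, h2, h3]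
    unfold ss
    ring

theorem qq_eq (t : ℝ) (μ : YoungDiagram) : qq t μ = 1 + ss t * SS t μ := by
  unfold qq SS
  rw [sum_ups, sum_dns, cells_sum_rows μ (fun c => Real.exp (t * ((c.2 : ℝ) - c.1))), mul_sum]
  simp only [row_geom]
  set N := μ.card
  have hN : μ.rowLen N = 0 := rowLen_zero_of_card_le μ le_rfl
  have tele : ∀ M : ℕ, ∑ i ∈ range M, ((Real.exp (t * ((μ.rowLen i : ℝ) - i)) - Real.exp (t * ((μ.rowLen i : ℝ) - 1 - i)))
        + Real.exp (-t * (i + 1)) - Real.exp (-t * i)) =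
        ∑ i ∈ range M, (Real.exp (t * ((μ.rowLen i : ℝ) - i)) - Real.exp (t * ((μ.rowLen i : ℝ) - 1 - i))) + Real.exp (-t * M) - 1 := by
    intro M
    induction M with
    | zero => simp
    | succ M ih =>
      rw [sum_range_succ, ih, sum_range_succ]
      push_cast
      ring
  rw [tele]
  have main : ∀ M : ℕ, (∑ i ∈ (range (M + 1)).filter
      (fun i => i = 0 ∨ μ.rowLen i < μ.rowLen (i - 1)),
      Real.exp (t * ((μ.rowLen i : ℝ) - i))) - ∑ i ∈ (range M).filter
      (fun i => μ.rowLen (i + 1) < μ.rowLen i),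
      Real.exp (t * ((μ.rowLen i : ℝ) - 1 - i)) =
      ∑ i ∈ range M, (Real.exp (t * ((μ.rowLen i : ℝ) - i)) - Real.exp (t * ((μ.rowLen i : ℝ) - 1 - i))) + Real.exp (t * ((μ.rowLen M : ℝ) - M)) := by
    intro M
    induction M with
    | zero => simp [sum_filter]
    | succ M ih =>
      rw [sum_filter, sum_filter] at ih ⊢
      rw [sum_range_succ _ (M + 1)]
      generalize ∑ a ∈ range (M + 1), (if a = 0 ∨ μ.rowLen a < μ.rowLen (a - 1) then
        Real.exp (t * ((μ.rowLen a : ℝ) - a)) else 0) = X at ih ⊢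
      rw [sum_range_succ _ M, sum_range_succ _ M]
      by_cases hlt : μ.rowLen (M + 1) < μ.rowLen M
      · rw [if_pos (Or.inr (by simpa using hlt)), if_pos hlt]
        linarith
      · have heq : μ.rowLen (M + 1) = μ.rowLen M := by
          have := μ.rowLen_anti M (M + 1) (by omega)
          omega
        rw [if_neg (by simp [heq]), if_neg hlt]
        have e : Real.exp (t * ((μ.rowLen (M + 1) : ℝ) - ((M + 1 : ℕ) : ℝ))) =
            Real.exp (t * ((μ.rowLen M : ℝ) - 1 - M)) := by
          rw [heq]; congr 1; push_cast; ring
        rw [e]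
        linarith
  rw [main N, hN]
  rw [show t * (((0 : ℕ) : ℝ) - N) = -t * N by push_cast; ring]
  ring


noncomputable def dimAux : ℕ → YoungDiagram → ℝ
  | 0, _ => 1
  | n + 1, Λ => ∑ μ ∈ dns Λ, dimAux n μ

noncomputable def dim (Λ : YoungDiagram) : ℝ := dimAux Λ.card Λ

theorem dim_bot : dim ⊥ = 1 := by
  simp [dim, YoungDiagram.card, dimAux]

theorem dim_rec {n : ℕ} {Λ : YoungDiagram} (h : Λ ∈ lev (n + 1)) :
    dim Λ = ∑ μ ∈ dns Λ, dim μ := by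
  rw [mem_lev] at h
  unfold dim
  rw [h]
  simp only [dimAux]
  refine sum_congr rfl fun μ hμ => ?_
  rw [mem_dns] at hμ
  rw [show μ.card = n by omega]

theorem lev_zero : lev 0 = {⊥} := by
  ext μ
  rw [mem_lev, mem_singleton]
  constructor
  · intro h
    apply YoungDiagram.ext
    rw [YoungDiagram.cells_bot]
    exact card_eq_zero.1 h
  · rintro rfl
    simp [YoungDiagram.card]

theorem mem_lev_of_dns {n : ℕ} {μ Λ : YoungDiagram} (h : Λ ∈ lev (n + 1)) (hμ : μ ∈ dns Λ) :
    μ ∈ lev n := by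
  rw [mem_lev] at *
  rw [mem_dns] at hμ
  omega

theorem mem_lev_of_ups {n : ℕ} {μ Λ : YoungDiagram} (h : μ ∈ lev n) (hμ : Λ ∈ ups μ) :
    Λ ∈ lev (n + 1) := by
  rw [mem_lev] at *
  rw [mem_ups] at hμ
  omega

theorem dns_lev_zero {μ : YoungDiagram} (h : μ ∈ lev 0) : dns μ = ∅ := by
  rw [eq_empty_iff_forall_notMem]
  intro ν hν
  rw [mem_lev] at h
  rw [mem_dns] at hν
  omega

theorem ups_iff_dns {μ Λ : YoungDiagram} : Λ ∈ ups μ ↔ μ ∈ dns Λ := by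
  rw [mem_ups, mem_dns]

theorem dimAux_nonneg (n : ℕ) : ∀ Λ, 0 ≤ dimAux n Λ := by
  induction n with
  | zero => intro Λ; simp [dimAux]
  | succ n ih => intro Λ; exact sum_nonneg fun μ _ => ih μ

theorem dim_nonneg (Λ : YoungDiagram) : 0 ≤ dim Λ := dimAux_nonneg _ _

theorem swap_edges (n : ℕ) (f : YoungDiagram → YoungDiagram → ℝ) :
    ∑ μ ∈ lev n, ∑ Λ ∈ ups μ, f μ Λ = ∑ Λ ∈ lev (n + 1), ∑ μ ∈ dns Λ, f μ Λ := by
  apply sum_comm'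
  intro μ Λ
  constructor
  · rintro ⟨h1, h2⟩
    exact ⟨ups_iff_dns.1 h2, mem_lev_of_ups h1 h2⟩
  · rintro ⟨h1, h2⟩
    exact ⟨mem_lev_of_dns h2 h1, ups_iff_dns.2 h1⟩

open Classical in
theorem comm_apply (t : ℝ) {n : ℕ} {μ : YoungDiagram} (hμ : μ ∈ lev n) (g : YoungDiagram → ℝ) :
    ∑ Λ ∈ ups μ, wt t μ Λ * ∑ ν ∈ dns Λ, g ν =
      qq t μ * g μ + ∑ κ ∈ dns μ, ∑ ν ∈ ups κ, wt t κ ν * g ν := by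
  have e1 : ∑ Λ ∈ ups μ, wt t μ Λ * ∑ ν ∈ dns Λ, g ν =
      ∑ ν ∈ lev n, ∑ Λ ∈ ups μ ∩ ups ν, wt t μ Λ * g ν := by
    simp only [mul_sum]
    apply sum_comm'
    intro Λ ν
    rw [mem_inter]
    constructor
    · rintro ⟨h1, h2⟩
      exact ⟨⟨h1, ups_iff_dns.2 h2⟩, mem_lev_of_dns (mem_lev_of_ups hμ h1) h2⟩
    · rintro ⟨⟨h1, h2⟩, h3⟩
      exact ⟨h1, ups_iff_dns.1 h2⟩
  have e2 : ∑ κ ∈ dns μ, ∑ ν ∈ ups κ, wt t κ ν * g ν =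
      ∑ ν ∈ lev n, ∑ κ ∈ dns μ ∩ dns ν, wt t κ ν * g ν := by
    apply sum_comm'
    intro κ ν
    rw [mem_inter]
    constructor
    · rintro ⟨h1, h2⟩
      refine ⟨⟨h1, ups_iff_dns.1 h2⟩, ?_⟩
      rw [mem_lev] at *
      rw [mem_dns] at h1
      rw [mem_ups] at h2
      omega
    · rintro ⟨⟨h1, h2⟩, h3⟩
      exact ⟨h1, ups_iff_dns.2 h2⟩
  rw [e1, e2]
  have e3 : qq t μ * g μ = ∑ ν ∈ lev n, (if μ = ν then qq t μ else 0) * g ν := by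
    simp only [ite_mul, zero_mul]
    rw [sum_ite_eq, if_pos hμ]
  rw [e3, ← sum_add_distrib]
  refine sum_congr rfl fun ν hν => ?_
  rw [← sum_mul, ← sum_mul, commutation t hμ hν]
  ring

theorem wt_zero (μ Λ : YoungDiagram) : wt 0 μ Λ = 1 := by simp [wt]

theorem qq_zero (μ : YoungDiagram) : qq 0 μ = 1 := by
  rw [qq_eq]; simp [ss]; left; norm_num

theorem comm_apply0 {n : ℕ} {μ : YoungDiagram} (hμ : μ ∈ lev n) (g : YoungDiagram → ℝ) :
    ∑ Λ ∈ ups μ, ∑ ν ∈ dns Λ, g ν = g μ + ∑ κ ∈ dns μ, ∑ ν ∈ ups κ, g ν := by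
  have := comm_apply 0 hμ g
  simpa only [wt_zero, qq_zero, one_mul] using this

theorem dim_up (n : ℕ) : ∀ μ ∈ lev n, ∑ Λ ∈ ups μ, dim Λ = (n + 1) * dim μ := by
  induction n with
  | zero =>
    intro μ hμ
    have h := comm_apply0 hμ dim
    rw [dns_lev_zero hμ] at h
    rw [sum_congr rfl fun Λ hΛ => dim_rec (mem_lev_of_ups hμ hΛ), h]
    simp
  | succ n ih =>
    intro μ hμ
    have h := comm_apply0 hμ dim
    rw [sum_congr rfl fun Λ hΛ => dim_rec (mem_lev_of_ups hμ hΛ), h]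
    rw [sum_congr rfl fun κ hκ => ih κ (mem_lev_of_dns hμ hκ), ← mul_sum, ← dim_rec hμ]
    push_cast; ring

noncomputable def Ex (n : ℕ) (F : YoungDiagram → ℝ) : ℝ :=
  (∑ Λ ∈ lev n, dim Λ ^ 2 * F Λ) / (n.factorial : ℝ)

noncomputable def EE (n : ℕ) (f : YoungDiagram → YoungDiagram → ℝ) : ℝ :=
  (∑ μ ∈ lev n, ∑ Λ ∈ ups μ, dim μ * dim Λ * f μ Λ) / ((n + 1).factorial : ℝ)

theorem fst_sum (n : ℕ) (F : YoungDiagram → ℝ) :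
    ∑ μ ∈ lev n, ∑ Λ ∈ ups μ, dim μ * dim Λ * F μ =
      (n + 1) * ∑ Λ ∈ lev n, dim Λ ^ 2 * F Λ := by
  rw [mul_sum]
  refine sum_congr rfl fun μ hμ => ?_
  rw [sum_congr rfl fun Λ _ => (show dim μ * dim Λ * F μ = dim μ * F μ * dim Λ by ring),
    ← mul_sum, dim_up n μ hμ]
  ring

theorem snd_sum (n : ℕ) (F : YoungDiagram → ℝ) :
    ∑ μ ∈ lev n, ∑ Λ ∈ ups μ, dim μ * dim Λ * F Λ = ∑ Λ ∈ lev (n + 1), dim Λ ^ 2 * F Λ := by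
  rw [swap_edges n (fun μ Λ => dim μ * dim Λ * F Λ)]
  refine sum_congr rfl fun Λ hΛ => ?_
  rw [sum_congr rfl fun μ _ => (show dim μ * dim Λ * F Λ = dim μ * (dim Λ * F Λ) by ring),
    ← sum_mul, ← dim_rec hΛ]
  ring

theorem EE_fst (n : ℕ) (F : YoungDiagram → ℝ) : EE n (fun μ _ => F μ) = Ex n F := by
  unfold EE Ex
  rw [fst_sum, Nat.factorial_succ]
  have : (n.factorial : ℝ) ≠ 0 := by positivity
  push_cast
  field_simp

theorem EE_snd (n : ℕ) (F : YoungDiagram → ℝ) : EE n (fun _ Λ => F Λ) = Ex (n + 1) F := by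
  unfold EE Ex
  rw [snd_sum]

theorem sum_sq (n : ℕ) : ∑ Λ ∈ lev n, dim Λ ^ 2 = n.factorial := by
  induction n with
  | zero => simp [lev_zero, dim_bot]
  | succ n ih =>
    have h1 := snd_sum n (fun _ => 1)
    have h2 := fst_sum n (fun _ => 1)
    simp only [mul_one] at h1 h2
    rw [← h1, h2, ih, Nat.factorial_succ]
    push_cast; ring

theorem Ex_const (n : ℕ) (c : ℝ) : Ex n (fun _ => c) = c := by
  unfold Ex
  rw [← sum_mul, sum_sq]
  have : (n.factorial : ℝ) ≠ 0 := by positivity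
  field_simp

theorem EE_const (n : ℕ) (c : ℝ) : EE n (fun _ _ => c) = c := by
  rw [EE_fst n (fun _ => c), Ex_const]

theorem Ex_add (n : ℕ) (F G : YoungDiagram → ℝ) :
    Ex n (fun Λ => F Λ + G Λ) = Ex n F + Ex n G := by
  unfold Ex
  simp only [mul_add, sum_add_distrib, add_div]

theorem Ex_smul (n : ℕ) (c : ℝ) (F : YoungDiagram → ℝ) :
    Ex n (fun Λ => c * F Λ) = c * Ex n F := by
  unfold Ex
  rw [← mul_div_assoc, mul_sum]
  congr 1
  exact sum_congr rfl fun _ _ => by ring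

theorem Ex_mono (n : ℕ) {F G : YoungDiagram → ℝ} (h : ∀ Λ ∈ lev n, F Λ ≤ G Λ) :
    Ex n F ≤ Ex n G := by
  unfold Ex
  gcongr with Λ hΛ
  exact h Λ hΛ

theorem EE_add (n : ℕ) (f g : YoungDiagram → YoungDiagram → ℝ) :
    EE n (fun μ Λ => f μ Λ + g μ Λ) = EE n f + EE n g := by
  unfold EE
  simp only [mul_add, sum_add_distrib, add_div]

theorem EE_smul (n : ℕ) (c : ℝ) (f : YoungDiagram → YoungDiagram → ℝ) :
    EE n (fun μ Λ => c * f μ Λ) = c * EE n f := by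
  unfold EE
  rw [← mul_div_assoc, mul_sum]
  congr 1
  refine sum_congr rfl fun _ _ => ?_
  rw [mul_sum]
  exact sum_congr rfl fun _ _ => by ring

theorem EE_mono (n : ℕ) {f g : YoungDiagram → YoungDiagram → ℝ}
    (h : ∀ μ ∈ lev n, ∀ Λ ∈ ups μ, f μ Λ ≤ g μ Λ) : EE n f ≤ EE n g := by
  unfold EE
  apply div_le_div_of_nonneg_right _ (by positivity)
  refine sum_le_sum fun μ hμ => sum_le_sum fun Λ hΛ => ?_
  exact mul_le_mul_of_nonneg_left (h μ hμ Λ hΛ) (mul_nonneg (dim_nonneg _) (dim_nonneg _))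

theorem EE_congr (n : ℕ) {f g : YoungDiagram → YoungDiagram → ℝ}
    (h : ∀ μ ∈ lev n, ∀ Λ ∈ ups μ, f μ Λ = g μ Λ) : EE n f = EE n g :=
  le_antisymm (EE_mono n fun μ hμ Λ hΛ => (h μ hμ Λ hΛ).le)
    (EE_mono n fun μ hμ Λ hΛ => (h μ hμ Λ hΛ).ge)

theorem Ex_succ (n : ℕ) (F : YoungDiagram → ℝ) :
    Ex (n + 1) F = Ex n F + EE n (fun μ Λ => F Λ - F μ) := by
  rw [← EE_snd, ← EE_fst, ← EE_add]
  congr 1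
  funext μ Λ
  ring

theorem Ex_telescope (n : ℕ) (F : YoungDiagram → ℝ) :
    Ex n F = F ⊥ + ∑ i ∈ range n, EE i (fun μ Λ => F Λ - F μ) := by
  induction n with
  | zero => simp [Ex, lev_zero, dim_bot]
  | succ n ih => rw [Ex_succ, ih, sum_range_succ]; ring

noncomputable def al (t : ℝ) (n : ℕ) : ℝ := EE n (wt t)

noncomputable def be (t : ℝ) (n : ℕ) : ℝ := ∑ μ ∈ lev n, ∑ Λ ∈ ups μ, dim μ * dim Λ * wt t μ Λ

theorem be_eq (t : ℝ) (n : ℕ) : be t n = ∑ μ ∈ lev n, dim μ ^ 2 * qq t μ +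
    ∑ μ ∈ lev n, ∑ κ ∈ dns μ, dim μ * ∑ ν ∈ ups κ, wt t κ ν * dim ν := by
  unfold be
  rw [← sum_add_distrib]
  refine sum_congr rfl fun μ hμ => ?_
  have h := comm_apply t hμ dim
  rw [← mul_sum]
  rw [show dim μ ^ 2 * qq t μ = dim μ * (qq t μ * dim μ) by ring, ← mul_add, ← h, mul_sum]
  refine sum_congr rfl fun Λ hΛ => ?_
  rw [← dim_rec (mem_lev_of_ups hμ hΛ)]
  ring

theorem be_zero (t : ℝ) : be t 0 = ∑ μ ∈ lev 0, dim μ ^ 2 * qq t μ := by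
  rw [be_eq]
  rw [add_eq_left]
  refine sum_eq_zero fun μ hμ => ?_
  rw [dns_lev_zero hμ]; simp

theorem be_succ (t : ℝ) (n : ℕ) :
    be t (n + 1) = ∑ μ ∈ lev (n + 1), dim μ ^ 2 * qq t μ + (n + 1) * be t n := by
  rw [be_eq]
  congr 1
  rw [← swap_edges n (fun κ μ => dim μ * ∑ ν ∈ ups κ, wt t κ ν * dim ν)]
  unfold be
  rw [mul_sum]
  refine sum_congr rfl fun κ hκ => ?_
  rw [← sum_mul, dim_up n κ hκ, mul_sum, mul_sum]
  exact sum_congr rfl fun _ _ => by ring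

theorem SS_edge (t : ℝ) {μ Λ : YoungDiagram} (h : Λ ∈ ups μ) : SS t Λ - SS t μ = wt t μ Λ := by
  obtain ⟨i, hi⟩ := edge_row h
  unfold SS wt
  rw [cells_sum_edge hi, cont_edge hi]
  ring

theorem Ex_qq (t : ℝ) (n : ℕ) : Ex n (qq t) = 1 + ss t * ∑ i ∈ range n, al t i := by
  have h1 : qq t = fun μ => 1 + ss t * SS t μ := funext (qq_eq t)
  rw [h1, Ex_add n (fun _ => 1) (fun μ => ss t * SS t μ), Ex_const, Ex_smul, Ex_telescope]
  congr 2
  rw [show SS t ⊥ = 0 by simp [SS], zero_add]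
  refine sum_congr rfl fun i _ => ?_
  exact EE_congr i fun μ _ Λ hΛ => SS_edge t hΛ

theorem al_zero (t : ℝ) : al t 0 = 1 := by
  have h1 := be_zero t
  have h2 := Ex_qq t 0
  simp only [range_zero, sum_empty, mul_zero, add_zero, Ex, Nat.factorial, Nat.cast_one, div_one] at h2
  rw [h2] at h1
  unfold be at h1
  simp [al, EE, h1]

theorem al_succ (t : ℝ) (n : ℕ) : ((n : ℝ) + 2) * al t (n + 1) =
    1 + ss t * ∑ i ∈ range (n + 1), al t i + (n + 1) * al t n := by
  rw [← Ex_qq]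
  have h := be_succ t n
  have e1 : al t (n + 1) = be t (n + 1) / ((n + 2).factorial : ℝ) := rfl
  have e2 : al t n = be t n / ((n + 1).factorial : ℝ) := rfl
  rw [e1, e2, h]
  unfold Ex
  rw [Nat.factorial_succ (n + 1), Nat.factorial_succ n]
  have : (n.factorial : ℝ) ≠ 0 := by positivity
  push_cast
  field_simp
  ring

theorem al_formula (t : ℝ) (n : ℕ) :
    al t n = ∑ k ∈ range (n + 1), (n.choose k : ℝ) * ss t ^ k / ((k + 1).factorial : ℝ) ∧
    1 + ss t * ∑ i ∈ range (n + 1), al t i =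
      ∑ k ∈ range (n + 2), ((n + 1).choose k : ℝ) * ss t ^ k / (k.factorial : ℝ) := by
  induction n with
  | zero => simp [al_zero, sum_range_succ]
  | succ n ih =>
    obtain ⟨ih1, ih2⟩ := ih
    have hfirst : al t (n + 1) = ∑ k ∈ range (n + 2), ((n + 1).choose k : ℝ) * ss t ^ k / ((k + 1).factorial : ℝ) := by
      have h := al_succ t n
      rw [ih2, ih1] at h
      have e : ∑ k ∈ range (n + 1), (n.choose k : ℝ) * ss t ^ k / ((k + 1).factorial : ℝ) =
          ∑ k ∈ range (n + 2), (n.choose k : ℝ) * ss t ^ k / ((k + 1).factorial : ℝ) := by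
        rw [sum_range_succ _ (n + 1)]
        simp
      rw [e, mul_sum, ← sum_add_distrib] at h
      have hpos : ((n : ℝ) + 2) ≠ 0 := by positivity
      apply mul_left_cancel₀ hpos
      rw [h, mul_sum]
      refine sum_congr rfl fun k _ => ?_
      have c1 : ((n : ℝ) + 2) * ((n + 1).choose k : ℝ) = ((n + 2).choose (k + 1) : ℝ) * (k + 1) := by
        have := Nat.add_one_mul_choose_eq (n + 1) k
        exact_mod_cast this
      have c2 : ((n : ℝ) + 1) * (n.choose k : ℝ) = ((n + 1).choose (k + 1) : ℝ) * (k + 1) := by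
        have := Nat.add_one_mul_choose_eq n k
        exact_mod_cast this
      have c3 : ((n + 2).choose (k + 1) : ℝ) = ((n + 1).choose k : ℝ) + ((n + 1).choose (k + 1) : ℝ) := by
        exact_mod_cast Nat.choose_succ_succ (n + 1) k
      rw [Nat.factorial_succ k]
      have : (k.factorial : ℝ) ≠ 0 := by positivity
      push_cast
      field_simp
      linear_combination ss t ^ k * (-c1 + c2 - (k+1) * c3)
    refine ⟨hfirst, ?_⟩
    rw [sum_range_succ, mul_add, ← add_assoc, ih2, hfirst]
    have e : ∑ k ∈ range (n + 2), ((n + 1).choose k : ℝ) * ss t ^ k / (k.factorial : ℝ) =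
        ∑ k ∈ range (n + 3), ((n + 1).choose k : ℝ) * ss t ^ k / (k.factorial : ℝ) := by
      rw [sum_range_succ _ (n + 2)]
      simp
    rw [e, sum_range_succ' _ (n + 2), sum_range_succ' _ (n + 2), mul_sum, add_right_comm,
      ← sum_add_distrib]
    congr 1
    · refine sum_congr rfl fun k _ => ?_
      have c3 : ((n + 2).choose (k + 1) : ℝ) = ((n + 1).choose k : ℝ) + ((n + 1).choose (k + 1) : ℝ) := by
        exact_mod_cast Nat.choose_succ_succ (n + 1) k
      rw [show n + 1 + 1 = n + 2 from rfl, c3, pow_succ]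
      ring

theorem ss_nonneg (t : ℝ) : 0 ≤ ss t := by
  have h : ss t = 2 * (Real.cosh t - 1) := by unfold ss; rw [Real.cosh_eq]; ring
  rw [h]
  have := Real.one_le_cosh t
  linarith

theorem al_lower (t : ℝ) (n k : ℕ) :
    (n.choose k : ℝ) * ss t ^ k / ((k + 1).factorial : ℝ) ≤ al t n := by
  have hs := ss_nonneg t
  rw [(al_formula t n).1]
  by_cases hk : k ∈ range (n + 1)
  · exact single_le_sum (f := fun k => (n.choose k : ℝ) * ss t ^ k / ((k + 1).factorial : ℝ)) (fun i _ => by positivity) hk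
  · rw [mem_range] at hk
    rw [Nat.choose_eq_zero_of_lt (by omega)]
    simp only [Nat.cast_zero, zero_mul, zero_div]
    exact sum_nonneg fun i _ => by positivity

theorem al_upper (t : ℝ) (n : ℕ) : al t n ≤ Real.exp (n * ss t) := by
  have hs := ss_nonneg t
  rw [(al_formula t n).1]
  refine le_trans ?_ (Real.sum_le_exp_of_nonneg (x := n * ss t) (by positivity) (n + 1))
  refine sum_le_sum fun k _ => ?_
  rw [mul_pow]
  have h1 : (n.choose k : ℝ) ≤ (n : ℝ) ^ k := by exact_mod_cast Nat.choose_le_pow n k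
  have h2 : (k.factorial : ℝ) ≤ ((k + 1).factorial : ℝ) := by
    exact_mod_cast Nat.factorial_le (Nat.le_succ k)
  gcongr

theorem poincare_aux (n : ℕ) : ∀ v : YoungDiagram → ℝ, ∑ Λ ∈ lev (n + 1), dim Λ * v Λ = 0 →
    ∑ μ ∈ lev n, (∑ Λ ∈ ups μ, v Λ) ^ 2 ≤ n * ∑ Λ ∈ lev (n + 1), v Λ ^ 2 := by
  have hsum : ∀ n : ℕ, ∀ v : YoungDiagram → ℝ, ∑ Λ ∈ lev (n + 1), dim Λ * v Λ =
      ∑ μ ∈ lev n, dim μ * ∑ Λ ∈ ups μ, v Λ := by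
    intro n v
    simp only [mul_sum]
    rw [swap_edges n (fun μ Λ => dim μ * v Λ)]
    refine sum_congr rfl fun Λ hΛ => ?_
    rw [← sum_mul, ← dim_rec hΛ]
  induction n with
  | zero =>
    intro v hv
    rw [hsum, lev_zero, sum_singleton, dim_bot, one_mul] at hv
    simp [lev_zero, hv]
  | succ n ih =>
    intro v hv
    set w : YoungDiagram → ℝ := fun μ => ∑ Λ ∈ ups μ, v Λ with hw
    rw [hsum] at hv
    have hD := ih w hv
    have hW : 0 ≤ ∑ μ ∈ lev (n + 1), w μ ^ 2 := sum_nonneg fun _ _ => sq_nonneg _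
    have hV : 0 ≤ ∑ Λ ∈ lev (n + 1 + 1), v Λ ^ 2 := sum_nonneg fun _ _ => sq_nonneg _
    -- norm of U w
    have hU : ∑ Λ ∈ lev (n + 1 + 1), (∑ μ ∈ dns Λ, w μ) ^ 2 =
        ∑ μ ∈ lev (n + 1), w μ ^ 2 + ∑ κ ∈ lev n, (∑ μ ∈ ups κ, w μ) ^ 2 := by
      have a1 : ∑ Λ ∈ lev (n + 1 + 1), (∑ μ ∈ dns Λ, w μ) ^ 2 =
          ∑ μ ∈ lev (n + 1), ∑ Λ ∈ ups μ, w μ * ∑ ν ∈ dns Λ, w ν := by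
        rw [swap_edges (n + 1) (fun μ Λ => w μ * ∑ ν ∈ dns Λ, w ν)]
        refine sum_congr rfl fun Λ _ => ?_
        rw [← sum_mul, sq]
      have a2 : ∑ κ ∈ lev n, (∑ μ ∈ ups κ, w μ) ^ 2 =
          ∑ μ ∈ lev (n + 1), ∑ κ ∈ dns μ, w μ * ∑ ν ∈ ups κ, w ν := by
        rw [← swap_edges n (fun κ μ => w μ * ∑ ν ∈ ups κ, w ν)]
        refine sum_congr rfl fun Λ _ => ?_
        rw [← sum_mul, sq]
      rw [a1, a2, ← sum_add_distrib]
      refine sum_congr rfl fun μ hμ => ?_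
      rw [← mul_sum, ← mul_sum, comm_apply0 hμ w]
      ring
    have hCS : (∑ μ ∈ lev (n + 1), w μ ^ 2) ^ 2 ≤
        (∑ Λ ∈ lev (n + 1 + 1), v Λ ^ 2) * ∑ Λ ∈ lev (n + 1 + 1), (∑ μ ∈ dns Λ, w μ) ^ 2 := by
      have b1 : ∑ μ ∈ lev (n + 1), w μ ^ 2 = ∑ Λ ∈ lev (n + 1 + 1), v Λ * ∑ μ ∈ dns Λ, w μ := by
        simp only [mul_sum]
        rw [← swap_edges (n + 1) (fun μ Λ => v Λ * w μ)]
        refine sum_congr rfl fun μ _ => ?_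
        rw [← sum_mul, sq]
      rw [b1]
      exact sum_mul_sq_le_sq_mul_sq _ _ _
    rw [hU] at hCS
    generalize ∑ μ ∈ lev (n + 1), w μ ^ 2 = W at *
    generalize ∑ Λ ∈ lev (n + 1 + 1), v Λ ^ 2 = V at *
    push_cast
    by_contra hlt
    push Not at hlt
    have hn : (0 : ℝ) ≤ n := by positivity
    have hWpos : 0 < W := lt_of_le_of_lt (by positivity) hlt
    nlinarith [mul_le_mul_of_nonneg_left hD hV, mul_lt_mul_of_pos_right hlt hWpos]

theorem variance_bound (n : ℕ) (F : YoungDiagram → ℝ) (m : ℝ) (hm : Ex (n + 1) F = m) :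
    Ex (n + 1) (fun Λ => (F Λ - m) ^ 2) ≤ (n + 1) * EE n (fun μ Λ => (F Λ - F μ) ^ 2) := by
  have h0 : ∑ Λ ∈ lev (n + 1), dim Λ * (dim Λ * (F Λ - m)) = 0 := by
    have h1 : Ex (n + 1) (fun Λ => F Λ + (-m)) = 0 := by
      rw [Ex_add (n + 1) F (fun _ => -m), Ex_const, hm]; ring
    unfold Ex at h1
    rw [div_eq_zero_iff] at h1
    rcases h1 with h1 | h1
    · rw [← h1]
      exact sum_congr rfl fun _ _ => by ring
    · exact absurd h1 (by positivity)
  have hP := poincare_aux n (fun Λ => dim Λ * (F Λ - m)) h0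
  have hpos : (0 : ℝ) < n + 1 := by positivity
  have hexp : ∑ μ ∈ lev n, ∑ Λ ∈ ups μ, dim μ * dim Λ * (F Λ - F μ) ^ 2 =
      ∑ Λ ∈ lev (n + 1), dim Λ ^ 2 * (F Λ - m) ^ 2 +
      ∑ μ ∈ lev n, ((n + 1) * dim μ ^ 2 * (F μ - m) ^ 2 -
        2 * (dim μ * (F μ - m)) * ∑ Λ ∈ ups μ, dim Λ * (F Λ - m)) := by
    rw [← snd_sum n (fun Λ => (F Λ - m) ^ 2), ← sum_add_distrib]
    refine sum_congr rfl fun μ hμ => ?_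
    have hd := dim_up n μ hμ
    rw [show (n + 1) * dim μ ^ 2 * (F μ - m) ^ 2 = dim μ * (F μ - m) ^ 2 * ((n + 1) * dim μ) by ring,
      ← hd, mul_sum, mul_sum, ← sum_sub_distrib, ← sum_add_distrib]
    exact sum_congr rfl fun _ _ => by ring
  have hsq : ∑ μ ∈ lev n, ((n + 1) * dim μ ^ 2 * (F μ - m) ^ 2 -
        2 * (dim μ * (F μ - m)) * ∑ Λ ∈ ups μ, dim Λ * (F Λ - m)) ≥
      - ((∑ μ ∈ lev n, (∑ Λ ∈ ups μ, dim Λ * (F Λ - m)) ^ 2) / (n + 1)) := by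
    rw [sum_div, ← sum_neg_distrib]
    refine sum_le_sum fun μ _ => ?_
    generalize ∑ Λ ∈ ups μ, dim Λ * (F Λ - m) = z
    have : (n + 1) * dim μ ^ 2 * (F μ - m) ^ 2 - 2 * (dim μ * (F μ - m)) * z - -(z ^ 2 / (n + 1)) =
        ((n + 1) * (dim μ * (F μ - m)) - z) ^ 2 / (n + 1) := by
      field_simp
      ring
    have h2 : 0 ≤ ((n + 1) * (dim μ * (F μ - m)) - z) ^ 2 / ((n : ℝ) + 1) := by positivity
    linarith
  unfold Ex EE
  rw [← mul_div_assoc]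
  apply div_le_div_of_nonneg_right _ (by positivity)
  rw [hexp]
  have e : ∑ Λ ∈ lev (n + 1), (dim Λ * (F Λ - m)) ^ 2 = ∑ Λ ∈ lev (n + 1), dim Λ ^ 2 * (F Λ - m) ^ 2 :=
    sum_congr rfl fun _ _ => by ring
  rw [e] at hP
  generalize ∑ Λ ∈ lev (n + 1), dim Λ ^ 2 * (F Λ - m) ^ 2 = V at *
  generalize ∑ μ ∈ lev n, (∑ Λ ∈ ups μ, dim Λ * (F Λ - m)) ^ 2 = D at *
  generalize ∑ μ ∈ lev n, ((n + 1) * dim μ ^ 2 * (F μ - m) ^ 2 -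
        2 * (dim μ * (F μ - m)) * ∑ Λ ∈ ups μ, dim Λ * (F Λ - m)) = Z at *
  have h3 : (n + 1) * (V + Z) ≥ (n + 1) * (V - D / (n + 1)) := by
    apply mul_le_mul_of_nonneg_left _ hpos.le
    linarith
  have h4 : ((n : ℝ) + 1) * (V - D / (n + 1)) = (n + 1) * V - D := by field_simp
  linarith

theorem row_upper (n r : ℕ) :
    EE n (fun μ Λ => (Λ.rowLen r : ℝ) - (μ.rowLen r : ℝ)) ≤ 1 / Real.sqrt (n + 1) := by
  set a := Real.sqrt (n + 1) with ha
  have hpos : (0 : ℝ) < n + 1 := by positivity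
  have hap : 0 < a := Real.sqrt_pos.2 hpos
  have ha2 : a ^ 2 = n + 1 := Real.sq_sqrt hpos.le
  set x : YoungDiagram → YoungDiagram → ℝ := fun μ Λ => (Λ.rowLen r : ℝ) - (μ.rowLen r : ℝ) with hx
  have hval : ∀ μ Λ, Λ ∈ ups μ → ∃ i, Λ.cells = insert (i, μ.rowLen i) μ.cells ∧
      x μ Λ = if r = i then 1 else 0 := by
    intro μ Λ h
    obtain ⟨i, hi⟩ := edge_row h
    refine ⟨i, hi, ?_⟩
    simp only [hx]
    rw [rowLen_insert hi r]
    push_cast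
    ring
  have hx0 : ∀ μ Λ, Λ ∈ ups μ → 0 ≤ x μ Λ := by
    intro μ Λ h
    obtain ⟨i, _, h2⟩ := hval μ Λ h
    rw [h2]; split_ifs <;> norm_num
  have hone : ∀ (s : Finset YoungDiagram) (g : YoungDiagram → ℝ),
      (∀ a ∈ s, g a = 0 ∨ g a = 1) → (∀ a ∈ s, ∀ b ∈ s, g a = 1 → g b = 1 → a = b) →
      ∑ a ∈ s, g a ≤ 1 := by
    intro s g h1 h2
    by_cases hex : ∃ a ∈ s, g a = 1
    · obtain ⟨a, has, hga⟩ := hex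
      rw [sum_eq_single_of_mem a has]
      · exact hga.le
      · intro b hb hne
        rcases h1 b hb with h | h
        · exact h
        · exact absurd (h2 b hb a has h hga) hne
    · push Not at hex
      rw [sum_eq_zero fun b hb => (h1 b hb).resolve_right (hex b hb)]
      norm_num
  have hup : ∀ μ, ∑ Λ ∈ ups μ, x μ Λ ≤ 1 := by
    intro μ
    apply hone
    · intro Λ h
      obtain ⟨i, _, h2⟩ := hval μ Λ h
      rw [h2]; split_ifs <;> simp
    · intro Λ h Λ' h' e e'
      obtain ⟨i, h1, h2⟩ := hval μ Λ h
      obtain ⟨i', h1', h2'⟩ := hval μ Λ' h'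
      rw [e] at h2
      rw [e'] at h2'
      have hi : r = i := by by_contra hne; simp [hne] at h2
      have hi' : r = i' := by by_contra hne; simp [hne] at h2'
      subst hi; subst hi'
      exact YoungDiagram.ext (h1.trans h1'.symm)
  have hdn : ∀ Λ, ∑ μ ∈ dns Λ, x μ Λ ≤ 1 := by
    intro Λ
    apply hone
    · intro μ h
      obtain ⟨i, _, h2⟩ := hval μ Λ (ups_iff_dns.2 h)
      rw [h2]; split_ifs <;> simp
    · intro μ h μ' h' e e'
      obtain ⟨i, h1, h2⟩ := hval μ Λ (ups_iff_dns.2 h)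
      obtain ⟨i', h1', h2'⟩ := hval μ' Λ (ups_iff_dns.2 h')
      rw [e] at h2
      rw [e'] at h2'
      have hi : r = i := by by_contra hne; simp [hne] at h2
      have hi' : r = i' := by by_contra hne; simp [hne] at h2'
      subst hi; subst hi'
      have r1 := (removable_of_edge h1).2
      have r2 := (removable_of_edge h1').2
      have r3 : μ.rowLen r = μ'.rowLen r := by omega
      apply YoungDiagram.ext
      rw [← erase_insert (notMem_rowLen μ r), ← erase_insert (notMem_rowLen μ' r), ← h1, ← h1', r3]
  have key : ∑ μ ∈ lev n, ∑ Λ ∈ ups μ, dim μ * dim Λ * x μ Λ ≤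
      ∑ μ ∈ lev n, ∑ Λ ∈ ups μ, (a / 2 * (dim μ ^ 2 * x μ Λ)) +
      ∑ μ ∈ lev n, ∑ Λ ∈ ups μ, (1 / (2 * a) * (dim Λ ^ 2 * x μ Λ)) := by
    rw [← sum_add_distrib]
    refine sum_le_sum fun μ _ => ?_
    rw [← sum_add_distrib]
    refine sum_le_sum fun Λ hΛ => ?_
    have hxx := hx0 μ Λ hΛ
    have e : a / 2 * (dim μ ^ 2 * x μ Λ) + 1 / (2 * a) * (dim Λ ^ 2 * x μ Λ) - dim μ * dim Λ * x μ Λ =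
        (a * dim μ - dim Λ) ^ 2 / (2 * a) * x μ Λ := by
      field_simp
      ring
    have h2 : 0 ≤ (a * dim μ - dim Λ) ^ 2 / (2 * a) * x μ Λ := by positivity
    linarith
  have k1 : ∑ μ ∈ lev n, ∑ Λ ∈ ups μ, (a / 2 * (dim μ ^ 2 * x μ Λ)) ≤ a / 2 * n.factorial := by
    rw [← sum_sq, mul_sum]
    refine sum_le_sum fun μ _ => ?_
    rw [← mul_sum, ← mul_sum]
    have := hup μ
    have h3 := mul_le_mul_of_nonneg_left this (sq_nonneg (dim μ))
    rw [mul_one] at h3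
    gcongr
  have k2 : ∑ μ ∈ lev n, ∑ Λ ∈ ups μ, (1 / (2 * a) * (dim Λ ^ 2 * x μ Λ)) ≤
      1 / (2 * a) * (n + 1).factorial := by
    rw [← sum_sq, mul_sum, swap_edges n (fun μ Λ => (1 / (2 * a) * (dim Λ ^ 2 * x μ Λ)))]
    refine sum_le_sum fun Λ _ => ?_
    rw [← mul_sum, ← mul_sum]
    have := hdn Λ
    have h3 := mul_le_mul_of_nonneg_left this (sq_nonneg (dim Λ))
    rw [mul_one] at h3
    gcongr
  unfold EE
  rw [div_le_iff₀ (by positivity)]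
  refine (key.trans (add_le_add k1 k2)).trans ?_
  rw [Nat.factorial_succ]
  push_cast
  rw [← ha2]
  apply le_of_eq
  field_simp
  ring


def IsSYT (μ : YoungDiagram) (T : μ.cells → Fin μ.card) : Prop :=
  Function.Bijective T ∧
      ∀ a b : μ.cells, (a : ℕ × ℕ).1 ≤ (b : ℕ × ℕ).1 → (a : ℕ × ℕ).2 ≤ (b : ℕ × ℕ).2 →
        a ≠ b → T a < T b

open Classical in
noncomputable def extT (μ Λ : YoungDiagram) (h : Λ ∈ ups μ) (T : μ.cells → Fin μ.card) :
    Λ.cells → Fin Λ.card := fun c =>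
  if hc : (c : ℕ × ℕ) ∈ μ.cells then
    ⟨(T ⟨c, hc⟩ : ℕ), by have := (T ⟨c, hc⟩).2; have := (mem_ups.1 h).2; omega⟩
  else ⟨μ.card, by have := (mem_ups.1 h).2; omega⟩

theorem extT_mem {μ Λ : YoungDiagram} (h : Λ ∈ ups μ) (T : μ.cells → Fin μ.card) (c : Λ.cells)
    (hc : (c : ℕ × ℕ) ∈ μ.cells) : (extT μ Λ h T c : ℕ) = T ⟨c, hc⟩ := by
  simp [extT, hc]

theorem extT_notMem {μ Λ : YoungDiagram} (h : Λ ∈ ups μ) (T : μ.cells → Fin μ.card) (c : Λ.cells)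
    (hc : (c : ℕ × ℕ) ∉ μ.cells) : (extT μ Λ h T c : ℕ) = μ.card := by
  simp [extT, hc]

theorem extT_syt {μ Λ : YoungDiagram} (h : Λ ∈ ups μ) (T : μ.cells → Fin μ.card)
    (hT : IsSYT μ T) : IsSYT Λ (extT μ Λ h T) := by
  obtain ⟨i, hi⟩ := edge_row h
  have hnew : ∀ c : Λ.cells, (c : ℕ × ℕ) ∉ μ.cells → (c : ℕ × ℕ) = (i, μ.rowLen i) := by
    intro c hc
    have := (Finset.ext_iff.1 hi (c : ℕ × ℕ)).1 c.2
    rw [mem_insert] at this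
    exact this.resolve_right hc
  have hcards := (mem_ups.1 h).2
  refine ⟨?_, ?_⟩
  · rw [Fintype.bijective_iff_injective_and_card]
    refine ⟨?_, by simp [YoungDiagram.card]⟩
    intro a b hab
    have hab' : (extT μ Λ h T a : ℕ) = extT μ Λ h T b := by rw [hab]
    by_cases ha : (a : ℕ × ℕ) ∈ μ.cells <;> by_cases hb : (b : ℕ × ℕ) ∈ μ.cells
    · rw [extT_mem h T a ha, extT_mem h T b hb] at hab'
      have := hT.1.1 (Fin.ext hab')
      simp only [Subtype.mk.injEq] at this
      exact Subtype.ext this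
    · rw [extT_mem h T a ha, extT_notMem h T b hb] at hab'
      have := (T ⟨a, ha⟩).2
      omega
    · rw [extT_notMem h T a ha, extT_mem h T b hb] at hab'
      have := (T ⟨b, hb⟩).2
      omega
    · exact Subtype.ext ((hnew a ha).trans (hnew b hb).symm)
  · intro a b h1 h2 hne
    rw [Fin.lt_def]
    by_cases hb : (b : ℕ × ℕ) ∈ μ.cells
    · have ha : (a : ℕ × ℕ) ∈ μ.cells := μ.up_left_mem h1 h2 hb
      rw [extT_mem h T a ha, extT_mem h T b hb]
      have := hT.2 ⟨a, ha⟩ ⟨b, hb⟩ h1 h2 (by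
        intro he
        simp only [Subtype.mk.injEq] at he
        exact hne (Subtype.ext he))
      exact this
    · have ha : (a : ℕ × ℕ) ∈ μ.cells := by
        by_contra ha
        exact hne (Subtype.ext ((hnew a ha).trans (hnew b hb).symm))
      rw [extT_mem h T a ha, extT_notMem h T b hb]
      exact (T ⟨a, ha⟩).2

theorem sytCount_eq (μ : YoungDiagram) : sytCount μ = Nat.card {T // IsSYT μ T} := rfl

theorem sytCount_ge (Λ : YoungDiagram) : ∑ μ ∈ dns Λ, sytCount μ ≤ sytCount Λ := by
  classical
  simp only [sytCount_eq, Nat.card_eq_fintype_card]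
  rw [← sum_coe_sort (dns Λ) (fun μ => Fintype.card {T // IsSYT μ T})]
  rw [← Fintype.card_sigma]
  let f : (Σ μ : dns Λ, {T // IsSYT μ.1 T}) → {T // IsSYT Λ T} := fun p =>
    ⟨extT p.1.1 Λ (ups_iff_dns.2 p.1.2) p.2.1, extT_syt _ _ p.2.2⟩
  refine Fintype.card_le_of_injective f ?_
  rintro ⟨⟨μ, hμ⟩, ⟨T, hT⟩⟩ ⟨⟨ν, hν⟩, ⟨S, hS⟩⟩ heq
  simp only [f, Subtype.mk.injEq] at heq
  have hμ' := ups_iff_dns.2 hμ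
  have hν' := ups_iff_dns.2 hν
  have hcards := (mem_ups.1 hμ').2
  have hcards' := (mem_ups.1 hν').2
  have hval : ∀ c, (extT μ Λ hμ' T c : ℕ) = extT ν Λ hν' S c := by
    intro c; rw [heq]
  have key : ∀ c : Λ.cells, (c : ℕ × ℕ) ∈ μ.cells ↔ (c : ℕ × ℕ) ∈ ν.cells := by
    intro c
    have hv := hval c
    by_cases ha : (c : ℕ × ℕ) ∈ μ.cells <;> by_cases hb : (c : ℕ × ℕ) ∈ ν.cells
    · simp [ha, hb]
    · rw [extT_mem hμ' T c ha, extT_notMem hν' S c hb] at hv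
      have := (T ⟨c, ha⟩).2
      omega
    · rw [extT_notMem hμ' T c ha, extT_mem hν' S c hb] at hv
      have := (S ⟨c, hb⟩).2
      omega
    · simp [ha, hb]
  have e : μ = ν := by
    apply YoungDiagram.ext
    ext c
    constructor
    · intro hc
      exact (key ⟨c, YoungDiagram.cells_subset_iff.2 (mem_ups.1 hμ').1 hc⟩).1 hc
    · intro hc
      exact (key ⟨c, YoungDiagram.cells_subset_iff.2 (mem_ups.1 hν').1 hc⟩).2 hc
  subst e
  have e2 : T = S := by
    funext c
    have hv := hval ⟨c, YoungDiagram.cells_subset_iff.2 (mem_ups.1 hμ').1 c.2⟩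
    rw [extT_mem hμ' T _ c.2, extT_mem hν' S _ c.2] at hv
    exact Fin.ext hv
  subst e2
  rfl

theorem sytCount_bot : 1 ≤ sytCount ⊥ := by
  classical
  rw [sytCount_eq, Nat.card_eq_fintype_card]
  apply Fintype.card_pos_iff.2
  have hemp : IsEmpty (↥(⊥ : YoungDiagram).cells) := by
    simp only [YoungDiagram.cells_bot]
    infer_instance
  refine ⟨⟨fun c => hemp.elim c, ⟨?_, ?_⟩, ?_⟩⟩
  · intro a; exact hemp.elim a
  · intro b; exact absurd b.2 (by simp [YoungDiagram.card])
  · intro a; exact hemp.elim a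

theorem dim_le_syt (n : ℕ) : ∀ Λ ∈ lev n, dim Λ ≤ sytCount Λ := by
  induction n with
  | zero =>
    intro Λ hΛ
    rw [lev_zero, mem_singleton] at hΛ
    subst hΛ
    rw [dim_bot]
    exact_mod_cast sytCount_bot
  | succ n ih =>
    intro Λ hΛ
    rw [dim_rec hΛ]
    have h1 : ∑ μ ∈ dns Λ, (sytCount μ : ℝ) ≤ sytCount Λ := by exact_mod_cast sytCount_ge Λ
    exact (sum_le_sum fun μ hμ => ih μ (mem_lev_of_dns hΛ hμ)).trans h1

theorem path_prob {Ω : Type*} [MeasurableSpace Ω] (P : Measure Ω)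
    (lam : ℕ → Ω → YoungDiagram) (h : IsPlancherelGrowthProcess P lam) (n : ℕ) :
    ∀ (N : ℕ) (path : ℕ → YoungDiagram), n ≤ N → path n ∈ lev n →
      (∀ i, n ≤ i → i < N → path (i + 1) ∈ ups (path i)) →
      dim (path n) * (sytCount (path N) : ℝ) / (N.factorial : ℝ) ≤
        P.real {ω | ∀ i, n ≤ i → i ≤ N → lam i ω = path i} := by
  obtain ⟨hP, hmeas, hpath⟩ := h
  induction n with
  | zero =>
    intro N path _ h0 hgrow
    rw [lev_zero, mem_singleton] at h0
    have := hpath N path h0 (fun i hi => mem_ups.1 (hgrow i (Nat.zero_le _) hi))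
    simp only [Nat.zero_le, true_imp_iff]
    rw [Measure.real, this, h0, dim_bot]
    simp
  | succ n ih =>
    intro N path hN h0 hgrow
    have hms : ∀ (path : ℕ → YoungDiagram) (n : ℕ), MeasurableSet {ω | ∀ i, n ≤ i → i ≤ N → lam i ω = path i} := by
      intro path n
      simp only [Set.ofPred_forall]
      refine MeasurableSet.iInter fun i => MeasurableSet.iInter fun _ => MeasurableSet.iInter fun _ => hmeas i _
    rw [dim_rec h0, sum_mul, sum_div]
    have hsub : (⋃ μ ∈ dns (path (n + 1)), {ω | ∀ i, n ≤ i → i ≤ N → lam i ω = Function.update path n μ i}) ⊆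
        {ω | ∀ i, n + 1 ≤ i → i ≤ N → lam i ω = path i} := by
      intro ω hω
      simp only [Set.mem_iUnion] at hω
      obtain ⟨μ, _, hω⟩ := hω
      intro i hi hiN
      have := hω i (by omega) hiN
      rwa [Function.update_of_ne (by omega)] at this
    refine le_trans ?_ (measureReal_mono hsub)
    rw [measureReal_biUnion_finset]
    · refine sum_le_sum fun μ hμ => ?_
      have := ih N (Function.update path n μ) (by omega) (by
        rw [Function.update_self]; exact mem_lev_of_dns h0 hμ) (by
        intro i hi hiN
        by_cases hin : i = n
        · subst hin
          rw [Function.update_self, Function.update_of_ne (by omega)]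
          exact ups_iff_dns.2 hμ
        · rw [Function.update_of_ne hin, Function.update_of_ne (by omega)]
          exact hgrow i (by omega) hiN)
      rw [Function.update_self, Function.update_of_ne (by omega)] at this
      exact this
    · intro μ _ ν _ hne
      rw [Function.onFun, Set.disjoint_left]
      intro ω h1 h2
      have a1 := h1 n le_rfl (by omega)
      have a2 := h2 n le_rfl (by omega)
      rw [Function.update_self] at a1 a2
      exact hne (a1.symm.trans a2)
    · intro μ _
      exact hms _ _

theorem edge_prob_ge {Ω : Type*} [MeasurableSpace Ω] (P : Measure Ω)
    (lam : ℕ → Ω → YoungDiagram) (h : IsPlancherelGrowthProcess P lam) (n : ℕ)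
    {μ Λ : YoungDiagram} (hμ : μ ∈ lev n) (hΛ : Λ ∈ ups μ) :
    dim μ * dim Λ / ((n + 1).factorial : ℝ) ≤ P.real {ω | lam n ω = μ ∧ lam (n + 1) ω = Λ} := by
  have hP := h.1
  have h1 := path_prob P lam h n (n + 1) (fun i => if i = n then μ else Λ) (by omega)
    (by simpa using hμ) (by
      intro i hi hi'
      have : i = n := by omega
      subst this
      simpa using hΛ)
  simp only [if_pos, Nat.succ_ne_self, if_false] at h1
  have h2 := dim_le_syt (n + 1) Λ (mem_lev_of_ups hμ hΛ)
  have h3 : {ω | ∀ i, n ≤ i → i ≤ n + 1 → lam i ω = if i = n then μ else Λ} ⊆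
      {ω | lam n ω = μ ∧ lam (n + 1) ω = Λ} := by
    intro ω hω
    have a1 := hω n le_rfl (by omega)
    have a2 := hω (n + 1) (by omega) le_rfl
    simp at a1 a2
    exact ⟨a1, a2⟩
  have h4 := measureReal_mono (μ := P) h3
  have h5 := dim_nonneg μ
  have h6 : dim μ * dim Λ / ((n + 1).factorial : ℝ) ≤
      dim μ * (sytCount Λ : ℝ) / ((n + 1).factorial : ℝ) := by gcongr
  exact h6.trans (le_trans (by simpa using h1) h4)

/-- For any predicate on edges the probability is at least the edge expectation. -/
theorem prob_ge {Ω : Type*} [MeasurableSpace Ω] (P : Measure Ω)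
    (lam : ℕ → Ω → YoungDiagram) (h : IsPlancherelGrowthProcess P lam) (n : ℕ)
    (x : YoungDiagram → YoungDiagram → ℝ) (S : Set Ω)
    (hx : ∀ μ ∈ lev n, ∀ Λ ∈ ups μ, x μ Λ ≤ 0 ∨ (x μ Λ ≤ 1 ∧
      {ω | lam n ω = μ ∧ lam (n + 1) ω = Λ} ⊆ S)) :
    EE n x ≤ P.real S := by
  classical
  have hP := h.1
  set E : Finset (YoungDiagram × YoungDiagram) :=
    ((lev n ×ˢ lev (n + 1)).filter (fun p => p.2 ∈ ups p.1)) with hE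
  set E' := E.filter (fun p => {ω | lam n ω = p.1 ∧ lam (n + 1) ω = p.2} ⊆ S) with hE'
  have e1 : EE n x = ∑ p ∈ E, dim p.1 * dim p.2 / ((n + 1).factorial : ℝ) * x p.1 p.2 := by
    unfold EE
    rw [sum_div]
    simp only [sum_div]
    rw [hE, sum_filter, sum_product]
    refine sum_congr rfl fun μ hμ => ?_
    rw [← sum_filter]
    have : (lev (n + 1)).filter (fun Λ => Λ ∈ ups μ) = ups μ := by
      ext Λ
      rw [mem_filter]
      exact ⟨fun h => h.2, fun h => ⟨mem_lev_of_ups hμ h, h⟩⟩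
    simp only
    rw [this]
    exact sum_congr rfl fun _ _ => by ring
  have hsub : (⋃ p ∈ E', {ω | lam n ω = p.1 ∧ lam (n + 1) ω = p.2}) ⊆ S := by
    intro ω hω
    simp only [Set.mem_iUnion] at hω
    obtain ⟨p, hp, hω⟩ := hω
    exact (mem_filter.1 hp).2 hω
  refine le_trans ?_ (measureReal_mono hsub)
  clear_value E'
  clear_value E
  rw [measureReal_biUnion_finset]
  · rw [e1, hE', sum_filter]
    refine sum_le_sum fun p hp => ?_
    rw [hE, mem_filter, mem_product] at hp
    have hge := edge_prob_ge P lam h n hp.1.1 hp.2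
    have hnn : 0 ≤ dim p.1 * dim p.2 / ((n + 1).factorial : ℝ) :=
      div_nonneg (mul_nonneg (dim_nonneg _) (dim_nonneg _)) (by positivity)
    have h3 := hx p.1 hp.1.1 p.2 hp.2
    split_ifs with hs
    · have : x p.1 p.2 ≤ 1 := by
        rcases h3 with h3 | h3
        · linarith
        · exact h3.1
      nlinarith
    · have : x p.1 p.2 ≤ 0 := by
        rcases h3 with h3 | h3
        · exact h3
        · exact absurd h3.2 hs
      nlinarith
  · intro p _ q _ hne
    rw [Function.onFun, Set.disjoint_left]
    rintro ω ⟨a1, a2⟩ ⟨b1, b2⟩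
    exact hne (Prod.ext (a1.symm.trans b1) (a2.symm.trans b2))
  · intro p _
    exact (h.2.1 n p.1).inter (h.2.1 (n + 1) p.2)

theorem growth_prob {Ω : Type*} [MeasurableSpace Ω] (P : Measure Ω)
    (lam : ℕ → Ω → YoungDiagram) (h : IsPlancherelGrowthProcess P lam) (n r : ℕ) :
    (P (growthEvent lam n r)).toReal =
      EE n (fun μ Λ => (Λ.rowLen r : ℝ) - (μ.rowLen r : ℝ)) := by
  have hP := h.1
  have hval : ∀ μ Λ, Λ ∈ ups μ → (Λ.rowLen r = μ.rowLen r ∨ Λ.rowLen r = μ.rowLen r + 1) := by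
    intro μ Λ hΛ
    obtain ⟨i, hi⟩ := edge_row hΛ
    rw [rowLen_insert hi r]
    split_ifs <;> simp
  set x : YoungDiagram → YoungDiagram → ℝ := fun μ Λ => (Λ.rowLen r : ℝ) - (μ.rowLen r : ℝ) with hx
  have h1 : EE n x ≤ P.real (growthEvent lam n r) := by
    apply prob_ge P lam h
    intro μ _ Λ hΛ
    rcases hval μ Λ hΛ with e | e
    · left; simp [hx, e]
    · right
      refine ⟨by simp [hx, e], ?_⟩
      rintro ω ⟨rfl, rfl⟩
      exact e
  set Sc : Set Ω := ⋃ p ∈ ((lev n ×ˢ lev (n + 1)).filter (fun p : YoungDiagram × YoungDiagram => p.2.rowLen r = p.1.rowLen r)),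
    {ω | lam n ω = p.1 ∧ lam (n + 1) ω = p.2} with hSc
  have hScm : MeasurableSet Sc :=
    Finset.measurableSet_biUnion _ fun p _ => (h.2.1 n p.1).inter (h.2.1 (n + 1) p.2)
  have h2 : EE n (fun μ Λ => 1 + (-1) * x μ Λ) ≤ P.real Sc := by
    apply prob_ge P lam h
    intro μ hμ Λ hΛ
    rcases hval μ Λ hΛ with e | e
    · right
      refine ⟨by simp [hx, e], ?_⟩
      intro ω hω
      simp only [hSc, Set.mem_iUnion]
      refine ⟨(μ, Λ), ?_, hω⟩
      simp only [mem_filter, mem_product]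
      exact ⟨⟨hμ, mem_lev_of_ups hμ hΛ⟩, e⟩
    · left; simp [hx, e]
  rw [EE_add n (fun _ _ => 1) (fun μ Λ => (-1) * x μ Λ), EE_const, EE_smul] at h2
  have h3 : growthEvent lam n r ⊆ Scᶜ := by
    intro ω hω hω'
    simp only [hSc, Set.mem_iUnion] at hω'
    obtain ⟨p, hp, hω'⟩ := hω'
    have e := (mem_filter.1 hp).2
    obtain ⟨e1, e2⟩ := hω'
    have : (lam (n + 1) ω).rowLen r = (lam n ω).rowLen r + 1 := hω
    rw [e1, e2] at this
    omega
  have h4 := measureReal_mono (μ := P) h3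
  rw [probReal_compl_eq_one_sub hScm] at h4
  apply le_antisymm
  · change P.real _ ≤ _
    linarith
  · exact h1

theorem sum_growth {Ω : Type*} [MeasurableSpace Ω] (P : Measure Ω)
    (lam : ℕ → Ω → YoungDiagram) (h : IsPlancherelGrowthProcess P lam) (n K : ℕ) :
    ∑ m ∈ range n, ∑ r ∈ range (K + 1), (P (growthEvent lam m r)).toReal =
      ∑ r ∈ range (K + 1), Ex n (fun Λ => (Λ.rowLen r : ℝ)) := by
  rw [sum_comm]
  refine sum_congr rfl fun r _ => ?_
  rw [Ex_telescope]
  have : (⊥ : YoungDiagram).rowLen r = 0 := rowLen_zero_of_card_le ⊥ (by simp [YoungDiagram.card])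
  rw [this]
  simp only [growth_prob P lam h, Nat.cast_zero, zero_add]


theorem fact_exp (k : ℕ) : ((k + 1).factorial : ℝ) * Real.exp (k + 1) ≤
    Real.exp 1 * ((k : ℝ) + 1) ^ (k + 2) := by
  induction k with
  | zero => simp
  | succ k ih =>
    have h1 : (((k : ℝ) + 1) / (k + 2)) ^ (k + 2) ≤ Real.exp (-1) := by
      have h2 : ((k : ℝ) + 1) / (k + 2) ≤ Real.exp (-(1 / ((k : ℝ) + 2))) := by
        have := Real.add_one_le_exp (-(1 / ((k : ℝ) + 2)))
        refine le_trans (le_of_eq ?_) this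
        field_simp
        ring
      calc _ ≤ (Real.exp (-(1 / ((k : ℝ) + 2)))) ^ (k + 2) := by gcongr
        _ = Real.exp (-1) := by
          rw [← Real.exp_nat_mul]
          congr 1
          push_cast
          field_simp
    have h3 : Real.exp 1 * ((k : ℝ) + 1) ^ (k + 2) ≤ ((k : ℝ) + 2) ^ (k + 2) := by
      rw [div_pow, div_le_iff₀ (by positivity)] at h1
      calc _ ≤ Real.exp 1 * (Real.exp (-1) * ((k : ℝ) + 2) ^ (k + 2)) := by gcongr
        _ = _ := by rw [← mul_assoc, ← Real.exp_add]; simp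
    have e1 : Real.exp ((k + 1 : ℕ) + 1) = Real.exp 1 * Real.exp (k + 1) := by
      rw [← Real.exp_add]; push_cast; ring_nf
    rw [Nat.factorial_succ, e1]
    push_cast at *
    calc ((k : ℝ) + 1 + 1) * ((k + 1).factorial : ℝ) * (Real.exp 1 * Real.exp (k + 1))
        = ((k : ℝ) + 2) * Real.exp 1 * (((k + 1).factorial : ℝ) * Real.exp (k + 1)) := by ring
      _ ≤ ((k : ℝ) + 2) * Real.exp 1 * (Real.exp 1 * ((k : ℝ) + 1) ^ (k + 2)) := by gcongr
      _ ≤ ((k : ℝ) + 2) * Real.exp 1 * ((k : ℝ) + 2) ^ (k + 2) := by gcongr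
      _ = _ := by ring

theorem exists_k {ε : ℝ} (h0 : 0 < ε) (h2 : ε < 2) : ∃ k : ℕ, 1 ≤ k ∧
    Real.exp ((2 - ε) * k) + 3 ≤ (k : ℝ) ^ (2 * k) / (k.factorial * (k + 1).factorial : ℝ) := by
  obtain ⟨k, hk⟩ := exists_nat_ge (192 * Real.exp 2 / ε ^ 4 + 1)
  have hk1 : (1 : ℝ) ≤ k := by
    have : 0 ≤ 192 * Real.exp 2 / ε ^ 4 := by positivity
    linarith
  have hk1' : 1 ≤ k := by exact_mod_cast hk1
  have hk2 : 192 * Real.exp 2 ≤ k * ε ^ 4 := by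
    rw [← div_le_iff₀ (by positivity)]; linarith
  refine ⟨k, hk1', ?_⟩
  have hf : (k.factorial : ℝ) * Real.exp k ≤ Real.exp 1 * (k : ℝ) ^ (k + 1) := by
    obtain ⟨j, rfl⟩ : ∃ j, k = j + 1 := ⟨k - 1, by omega⟩
    have := fact_exp j
    push_cast
    exact this
  rw [le_div_iff₀ (by positivity)]
  have hpos : 0 < Real.exp k ^ 2 := by positivity
  have e1 : 1 ≤ Real.exp ((2 - ε) * k) := Real.one_le_exp (by nlinarith)
  have e2 : 8 * Real.exp 2 * k ^ 3 ≤ Real.exp (ε * k) := by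
    have := Real.pow_div_factorial_le_exp (ε * k) (by positivity) 4
    refine le_trans ?_ this
    rw [show (((4 : ℕ).factorial : ℕ) : ℝ) = 24 by norm_num [Nat.factorial], le_div_iff₀ (by norm_num)]
    have h4 : (0 : ℝ) ≤ k ^ 3 := by positivity
    nlinarith
  have e3 : Real.exp ((2 - ε) * k) * Real.exp (ε * k) = Real.exp k ^ 2 := by
    rw [← Real.exp_add, ← Real.exp_nat_mul]; congr 1; push_cast; ring
  have e4 : Real.exp 1 ^ 2 = Real.exp 2 := by
    rw [← Real.exp_nat_mul]; norm_num
  refine le_of_mul_le_mul_right ?_ hpos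
  have hf2 : (k.factorial : ℝ) ^ 2 * Real.exp k ^ 2 ≤ Real.exp 2 * (k : ℝ) ^ (2 * k + 2) := by
    calc _ = ((k.factorial : ℝ) * Real.exp k) ^ 2 := by ring
      _ ≤ (Real.exp 1 * (k : ℝ) ^ (k + 1)) ^ 2 := by gcongr
      _ = _ := by rw [mul_pow, e4]; ring
  rw [Nat.factorial_succ]
  push_cast
  calc (Real.exp ((2 - ε) * k) + 3) * ((k.factorial : ℝ) * ((k + 1) * k.factorial)) * Real.exp k ^ 2
      = (Real.exp ((2 - ε) * k) + 3) * (k + 1) * ((k.factorial : ℝ) ^ 2 * Real.exp k ^ 2) := by ring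
    _ ≤ (4 * Real.exp ((2 - ε) * k)) * (2 * k) * (Real.exp 2 * (k : ℝ) ^ (2 * k + 2)) := by
        gcongr <;> linarith
    _ = Real.exp ((2 - ε) * k) * (8 * Real.exp 2 * k ^ 3) * (k : ℝ) ^ (2 * k) := by ring
    _ ≤ Real.exp ((2 - ε) * k) * Real.exp (ε * k) * (k : ℝ) ^ (2 * k) := by gcongr
    _ = _ := by rw [e3]; ring

theorem ss_ge (t : ℝ) : t ^ 2 ≤ ss t := by
  have h : ss t = 4 * Real.sinh (t / 2) ^ 2 := by
    have h1 : ss t = 2 * (Real.cosh (2 * (t / 2)) - 1) := by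
      unfold ss; rw [Real.cosh_eq]; ring_nf
    rw [h1, Real.cosh_two_mul, Real.cosh_sq]; ring
  have h2 : (t / 2) ^ 2 ≤ Real.sinh (t / 2) ^ 2 := by
    rcases le_total 0 (t / 2) with h0 | h0
    · have := Real.self_le_sinh_iff.2 h0
      nlinarith
    · have := Real.sinh_le_self_iff.2 h0
      nlinarith
  rw [h]; linarith

theorem ss_le {t : ℝ} (ht : t ^ 2 / 2 ≤ 1) : ss t ≤ 2 * t ^ 2 := by
  have h : ss t = 2 * (Real.cosh t - 1) := by unfold ss; rw [Real.cosh_eq]; ring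
  have h1 := Real.cosh_le_exp_half_sq t
  have h2 := Real.abs_exp_sub_one_le (x := t ^ 2 / 2) (by rwa [abs_of_nonneg (by positivity)])
  have h3 := (abs_le.1 h2).2
  rw [abs_of_nonneg (by positivity : 0 ≤ t ^ 2 / 2)] at h3
  rw [h]; linarith

theorem al_ev_lower {ε : ℝ} (h0 : 0 < ε) (h2 : ε < 2) : ∃ k : ℕ, 1 ≤ k ∧
    ∀ᶠ n : ℕ in atTop, Real.exp ((2 - ε) * k) + 2 ≤ al (k / Real.sqrt n) n := by
  obtain ⟨k, hk, h⟩ := exists_k h0 h2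
  refine ⟨k, hk, ?_⟩
  set L : ℝ := (k : ℝ) ^ (2 * k) / (k.factorial * (k + 1).factorial : ℝ) with hL
  have hlim : Tendsto (fun n : ℕ => (1 - (k : ℝ) / n) ^ k * L) atTop (nhds ((1 - 0) ^ k * L)) :=
    ((tendsto_const_nhds.sub (tendsto_const_div_atTop_nhds_zero_nat (k : ℝ))).pow k).mul_const L
  have hlt : Real.exp ((2 - ε) * k) + 2 < (1 - 0) ^ k * L := by
    rw [sub_zero, one_pow, one_mul]; linarith
  filter_upwards [hlim.eventually_const_lt hlt, eventually_ge_atTop (k + 1)] with n hn hnk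
  refine hn.le.trans (le_trans ?_ (al_lower _ n k))
  have hn0 : (0 : ℝ) < n := by
    have : 0 < n := by omega
    exact_mod_cast this
  have hs : ((k : ℝ) ^ 2 / n) ^ k ≤ ss (k / Real.sqrt n) ^ k := by
    have := ss_ge (k / Real.sqrt n)
    rw [div_pow, Real.sq_sqrt hn0.le] at this
    gcongr
  have hc : ((n : ℝ) - k) ^ k / k.factorial ≤ n.choose k := by
    rw [div_le_iff₀ (by positivity)]
    have h1 := Nat.pow_sub_le_descFactorial n k
    rw [Nat.descFactorial_eq_factorial_mul_choose] at h1
    have h3 : ((n : ℝ) - k) ^ k ≤ ((n + 1 - k : ℕ) : ℝ) ^ k := by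
      have : (k : ℝ) ≤ n := by
        have : k ≤ n := by omega
        exact_mod_cast this
      refine pow_le_pow_left₀ (by linarith) ?_ k
      rw [Nat.cast_sub (by omega)]; push_cast; linarith
    have h4 : ((n + 1 - k : ℕ) : ℝ) ^ k ≤ (k.factorial : ℝ) * n.choose k := by exact_mod_cast h1
    linarith
  have hs0 : 0 ≤ ss (k / Real.sqrt n) := ss_nonneg _
  calc (1 - (k : ℝ) / n) ^ k * L
      = (((n : ℝ) - k) ^ k / k.factorial) * ((k : ℝ) ^ 2 / n) ^ k / ((k + 1).factorial : ℝ) := by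
        rw [hL, show 1 - (k : ℝ) / n = ((n : ℝ) - k) / n by field_simp, div_pow, div_pow, pow_mul]
        field_simp
    _ ≤ (n.choose k : ℝ) * ss (k / Real.sqrt n) ^ k / ((k + 1).factorial : ℝ) := by gcongr

theorem al_ev_upper (k : ℕ) :
    ∀ᶠ n : ℕ in atTop, al (2 * (k / Real.sqrt n)) n ≤ Real.exp (8 * k ^ 2) := by
  filter_upwards [eventually_ge_atTop (2 * k ^ 2), eventually_ge_atTop 1] with n hn hn1
  refine (al_upper _ n).trans ?_
  have hn0 : (0 : ℝ) < n := by exact_mod_cast hn1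
  have hn' : 2 * (k : ℝ) ^ 2 ≤ n := by exact_mod_cast hn
  have e : (2 * ((k : ℝ) / Real.sqrt n)) ^ 2 = 4 * k ^ 2 / n := by
    rw [mul_pow, div_pow, Real.sq_sqrt hn0.le]; ring
  have := ss_le (t := 2 * (k / Real.sqrt n)) (by
    rw [e, div_div, div_le_one (by positivity)]; linarith)
  rw [e] at this
  apply Real.exp_le_exp.2
  calc (n : ℝ) * ss _ ≤ n * (2 * (4 * k ^ 2 / n)) := by gcongr
    _ = 8 * k ^ 2 := by field_simp; ring

open Classical in
noncomputable def win (x y c : ℝ) : ℝ := if x < c ∧ c ≤ y then 1 else 0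

theorem win_nonneg (x y c : ℝ) : 0 ≤ win x y c := by
  unfold win; split_ifs <;> norm_num

theorem win_le_one (x y c : ℝ) : win x y c ≤ 1 := by
  unfold win; split_ifs <;> norm_num

theorem win_mono {x y x' y' : ℝ} (hx : x' ≤ x) (hy : y ≤ y') (c : ℝ) : win x y c ≤ win x' y' c := by
  unfold win
  split_ifs with h1 h2 h2
  · rfl
  · exact absurd ⟨hx.trans_lt h1.1, h1.2.trans hy⟩ h2
  · norm_num
  · rfl

theorem win_prob {ε : ℝ} (h0 : 0 < ε) (h2 : ε < 2) : ∃ B > (0 : ℝ), ∃ δ > (0 : ℝ),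
    ∀ᶠ n : ℕ in atTop, δ ≤ EE n (fun μ Λ =>
      win ((2 - ε) * Real.sqrt n) (B * Real.sqrt n) (cont Λ - cont μ)) := by
  obtain ⟨k, hk, h⟩ := al_ev_lower h0 h2
  have hk0 : (0 : ℝ) < k := by exact_mod_cast hk
  refine ⟨8 * k, by positivity, Real.exp (-(8 * k ^ 2)), by positivity, ?_⟩
  filter_upwards [h, al_ev_upper k, eventually_ge_atTop 1] with n hl hu hn
  have hn0 : (0 : ℝ) < n := by exact_mod_cast hn
  have hs : 0 < Real.sqrt n := Real.sqrt_pos.2 hn0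
  set s := Real.sqrt n with hsdef
  set W : YoungDiagram → YoungDiagram → ℝ := fun μ Λ =>
      win ((2 - ε) * s) (8 * k * s) (cont Λ - cont μ) with hW
  have key : EE n (wt (k / s)) ≤ EE n (fun μ Λ => Real.exp ((2 - ε) * k) +
      (Real.exp (8 * k ^ 2) * W μ Λ + Real.exp (-(8 * k ^ 2)) * wt (2 * (k / s)) μ Λ)) := by
    apply EE_mono
    intro μ _ Λ _
    simp only [wt, hW]
    set c := cont Λ - cont μ
    have hw := win_nonneg ((2 - ε) * s) (8 * k * s) c
    by_cases c1 : c ≤ (2 - ε) * s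
    · have : Real.exp (k / s * c) ≤ Real.exp ((2 - ε) * k) := by
        apply Real.exp_le_exp.2
        rw [div_mul_eq_mul_div, div_le_iff₀ hs]
        nlinarith
      have p1 : 0 ≤ Real.exp (8 * k ^ 2) * win ((2 - ε) * s) (8 * k * s) c := by positivity
      have p2 : 0 ≤ Real.exp (-(8 * (k : ℝ) ^ 2)) * Real.exp (2 * (k / s) * c) := by positivity
      linarith
    · push Not at c1
      by_cases c2 : c ≤ 8 * k * s
      · have e : win ((2 - ε) * s) (8 * k * s) c = 1 := by simp [win, c1, c2]
        have : Real.exp (k / s * c) ≤ Real.exp (8 * k ^ 2) := by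
          apply Real.exp_le_exp.2
          rw [div_mul_eq_mul_div, div_le_iff₀ hs]
          nlinarith
        rw [e]
        have p1 : 0 ≤ Real.exp ((2 - ε) * k) := by positivity
        have p2 : 0 ≤ Real.exp (-(8 * (k : ℝ) ^ 2)) * Real.exp (2 * (k / s) * c) := by positivity
        linarith
      · push Not at c2
        have : Real.exp (k / s * c) ≤ Real.exp (-(8 * (k : ℝ) ^ 2)) * Real.exp (2 * (k / s) * c) := by
          rw [← Real.exp_add]
          apply Real.exp_le_exp.2
          have : 8 * (k : ℝ) ^ 2 ≤ k / s * c := by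
            rw [div_mul_eq_mul_div, le_div_iff₀ hs]
            nlinarith
          linarith
        have p1 : 0 ≤ Real.exp ((2 - ε) * k) := by positivity
        have p2 : 0 ≤ Real.exp (8 * k ^ 2) * win ((2 - ε) * s) (8 * k * s) c := by positivity
        linarith
  rw [EE_add n (fun _ _ => Real.exp ((2 - ε) * k)) (fun μ Λ => Real.exp (8 * k ^ 2) * W μ Λ +
    Real.exp (-(8 * k ^ 2)) * wt (2 * (k / s)) μ Λ), EE_const,
    EE_add n (fun μ Λ => Real.exp (8 * k ^ 2) * W μ Λ)
      (fun μ Λ => Real.exp (-(8 * k ^ 2)) * wt (2 * (k / s)) μ Λ), EE_smul, EE_smul] at key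
  change al (k / s) n ≤ _ + (_ + _ * al (2 * (k / s)) n) at key
  have h1 : Real.exp (-(8 * (k : ℝ) ^ 2)) * al (2 * (k / s)) n ≤ 1 := by
    calc _ ≤ Real.exp (-(8 * (k : ℝ) ^ 2)) * Real.exp (8 * k ^ 2) := by gcongr
      _ = 1 := by rw [← Real.exp_add]; simp
  have h3 : 1 ≤ Real.exp (8 * (k : ℝ) ^ 2) * EE n W := by linarith
  rw [Real.exp_neg, inv_le_iff_one_le_mul₀ (by positivity), mul_comm]
  exact h3

noncomputable def FF (x y : ℝ) (Λ : YoungDiagram) : ℝ := ∑ c ∈ Λ.cells, win x y ((c.2 : ℝ) - c.1)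

theorem FF_edge (x y : ℝ) {μ Λ : YoungDiagram} (h : Λ ∈ ups μ) :
    FF x y Λ - FF x y μ = win x y (cont Λ - cont μ) := by
  obtain ⟨i, hi⟩ := edge_row h
  unfold FF
  rw [cont_edge hi, cells_sum_edge hi]
  simp

theorem FF_bot (x y : ℝ) : FF x y ⊥ = 0 := by simp [FF]

theorem FF_small {x y : ℝ} (hy : 0 ≤ y) {Λ : YoungDiagram} {r : ℕ} (hr : (Λ.rowLen r : ℝ) ≤ x) :
    FF x y Λ ≤ r * (y + r + 1) := by
  classical
  have e : FF x y Λ = ((Λ.cells.filter (fun c => x < (c.2 : ℝ) - c.1 ∧ (c.2 : ℝ) - c.1 ≤ y)).card : ℝ) := by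
    rw [card_filter]
    push_cast
    unfold FF win
    refine sum_congr rfl fun c _ => ?_
    congr
  rw [e]
  have hsub : Λ.cells.filter (fun c => x < (c.2 : ℝ) - c.1 ∧ (c.2 : ℝ) - c.1 ≤ y) ⊆
      range r ×ˢ range (⌊y + r⌋₊ + 1) := by
    rintro ⟨i, j⟩ hc
    rw [mem_filter, YoungDiagram.mem_cells, YoungDiagram.mem_iff_lt_rowLen] at hc
    simp only at hc
    obtain ⟨h1, h2, h3⟩ := hc
    have hir : i < r := by
      by_contra hcon
      push Not at hcon
      have h4 := Λ.rowLen_anti r i hcon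
      have h5 : (j : ℝ) < Λ.rowLen r := by exact_mod_cast h1.trans_le h4
      have h6 : (0 : ℝ) ≤ i := by positivity
      linarith
    rw [mem_product, mem_range, mem_range]
    refine ⟨hir, ?_⟩
    have h7 : (i : ℝ) ≤ r := by exact_mod_cast hir.le
    have : j ≤ ⌊y + r⌋₊ := Nat.le_floor (by linarith)
    simp only
    omega
  have hc := card_le_card hsub
  rw [card_product, card_range, card_range] at hc
  have hc' : ((Λ.cells.filter (fun c => x < (c.2 : ℝ) - c.1 ∧ (c.2 : ℝ) - c.1 ≤ y)).card : ℝ) ≤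
      r * (⌊y + r⌋₊ + 1) := by exact_mod_cast hc
  refine hc'.trans ?_
  have := Nat.floor_le (show 0 ≤ y + r by positivity)
  gcongr

theorem FF_var (x y : ℝ) (N : ℕ) (hN : 1 ≤ N) :
    Ex N (fun Λ => (FF x y Λ - Ex N (FF x y)) ^ 2) ≤ N := by
  obtain ⟨n, rfl⟩ : ∃ n, N = n + 1 := ⟨N - 1, by omega⟩
  refine (variance_bound n (FF x y) _ rfl).trans ?_
  have h1 : EE n (fun μ Λ => (FF x y Λ - FF x y μ) ^ 2) ≤ EE n (fun _ _ => 1) := by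
    apply EE_mono
    intro μ _ Λ hΛ
    rw [FF_edge x y hΛ]
    exact pow_le_one₀ (win_nonneg _ _ _) (win_le_one _ _ _)
  rw [EE_const] at h1
  push_cast
  nlinarith [(Nat.cast_nonneg n : (0 : ℝ) ≤ n)]

theorem FF_mean {ε : ℝ} (h0 : 0 < ε) (h2 : ε < 1) : ∃ B > (0 : ℝ), ∃ η > (0 : ℝ),
    ∀ᶠ N : ℕ in atTop, η * N ≤
      Ex N (FF ((2 - ε) * (1 - ε) * Real.sqrt N) (B * Real.sqrt N)) := by
  obtain ⟨B, hB, δ, hδ, h⟩ := win_prob h0 (by linarith)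
  refine ⟨B, hB, δ * (ε / 2), by positivity, ?_⟩
  obtain ⟨n0, hn0⟩ := eventually_atTop.1 h
  obtain ⟨N1, hN1⟩ := exists_nat_ge ((n0 : ℝ) / (1 - ε))
  obtain ⟨N2, hN2⟩ := exists_nat_ge (2 / ε)
  filter_upwards [eventually_ge_atTop N1, eventually_ge_atTop N2] with N hA1 hA2
  have hA1' : (n0 : ℝ) ≤ (1 - ε) * N := by
    have : (n0 : ℝ) / (1 - ε) ≤ N := hN1.trans (by exact_mod_cast hA1)
    rw [div_le_iff₀ (by linarith)] at this
    linarith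
  have hA2' : 2 ≤ ε * N := by
    have : 2 / ε ≤ N := hN2.trans (by exact_mod_cast hA2)
    rw [div_le_iff₀ h0] at this
    linarith
  rw [Ex_telescope, FF_bot, zero_add]
  set x := (2 - ε) * (1 - ε) * Real.sqrt N with hx
  set y := B * Real.sqrt N with hy
  have hN0 : (0 : ℝ) ≤ N := by positivity
  set M := ⌈(1 - ε) * N⌉₊ with hM
  have hM1 : (1 - ε) * N ≤ M := Nat.le_ceil _
  have hM2 : (M : ℝ) < (1 - ε) * N + 1 := Nat.ceil_lt_add_one (by nlinarith)
  have hMN : M ≤ N := by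
    have : (M : ℝ) ≤ N := by nlinarith
    exact_mod_cast this
  calc δ * (ε / 2) * N ≤ ∑ i ∈ Ico M N, δ := by
        rw [sum_const, Nat.card_Ico, nsmul_eq_mul, Nat.cast_sub hMN]
        nlinarith
    _ ≤ ∑ i ∈ Ico M N, EE i (fun μ Λ => FF x y Λ - FF x y μ) := by
        refine sum_le_sum fun i hi => ?_
        rw [mem_Ico] at hi
        have hiM : (1 - ε) * N ≤ i := hM1.trans (by exact_mod_cast hi.1)
        have hin : n0 ≤ i := by
          have : (n0 : ℝ) ≤ i := hA1'.trans hiM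
          exact_mod_cast this
        refine (hn0 i hin).trans (EE_mono i fun μ _ Λ hΛ => ?_)
        rw [FF_edge x y hΛ]
        apply win_mono
        · have h3 : (1 - ε) * Real.sqrt N ≤ Real.sqrt i := by
            apply Real.le_sqrt_of_sq_le
            rw [mul_pow, Real.sq_sqrt hN0]
            nlinarith
          rw [hx, mul_assoc]
          exact mul_le_mul_of_nonneg_left h3 (by linarith)
        · have : (i : ℝ) ≤ N := by exact_mod_cast hi.2.le
          rw [hy]
          gcongr
    _ ≤ ∑ i ∈ range N, EE i (fun μ Λ => FF x y Λ - FF x y μ) := by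
        refine sum_le_sum_of_subset_of_nonneg ?_ ?_
        · intro i hi
          rw [mem_Ico] at hi
          exact mem_range.2 hi.2
        · intro i _ _
          rw [← EE_const i 0]
          refine EE_mono i fun μ _ Λ hΛ => ?_
          rw [FF_edge x y hΛ]
          exact win_nonneg _ _ _

theorem row_lower (r : ℕ) {ε : ℝ} (h0 : 0 < ε) (h2 : ε < 1) :
    ∀ᶠ N : ℕ in atTop, (2 - ε) * (1 - ε) * (1 - ε) * Real.sqrt N ≤
      Ex N (fun Λ => (Λ.rowLen r : ℝ)) := by
  obtain ⟨B, hB, η, hη, h⟩ := FF_mean h0 h2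
  have hs : Tendsto (fun N : ℕ => Real.sqrt N) atTop atTop :=
    Real.tendsto_sqrt_atTop.comp tendsto_natCast_atTop_atTop
  filter_upwards [h, eventually_ge_atTop 1, hs.eventually_ge_atTop 1,
    hs.eventually_ge_atTop (2 * r * (B + r + 1) / η),
    tendsto_natCast_atTop_atTop.eventually_ge_atTop (4 / (η ^ 2 * ε))] with N hm hN1 hs1 hs2 hN2
  set s := Real.sqrt N with hsdef
  have hN0 : (0 : ℝ) < N := by exact_mod_cast hN1
  have hss : s ^ 2 = N := Real.sq_sqrt hN0.le
  set x := (2 - ε) * (1 - ε) * s with hx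
  have hx0 : 0 ≤ x := by
    rw [hx]
    exact mul_nonneg (mul_nonneg (by linarith) (by linarith)) (by linarith)
  have hvar := FF_var x (B * s) N hN1
  set m := Ex N (FF x (B * s)) with hmdef
  have hm0 : 0 < m := lt_of_lt_of_le (by positivity) hm
  have hsmall : r * (B * s + r + 1) ≤ m / 2 := by
    have a1 : (r : ℝ) * (B * s + r + 1) ≤ r * ((B + r + 1) * s) := by
      have : (0 : ℝ) ≤ r := by positivity
      gcongr
      nlinarith
    rw [div_le_iff₀ hη] at hs2
    have a2 : 2 * r * (B + r + 1) * s ≤ s * η * s := by gcongr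
    have a3 : s * η * s = η * N := by rw [← hss]; ring
    linarith
  have key : Ex N (fun Λ => x + (-(x * (4 / m ^ 2))) * (FF x (B * s) Λ - m) ^ 2) ≤
      Ex N (fun Λ => (Λ.rowLen r : ℝ)) := by
    apply Ex_mono
    intro Λ _
    by_cases hc : (Λ.rowLen r : ℝ) ≤ x
    · have h3 := (FF_small (y := B * s) (by positivity) hc).trans hsmall
      have h4 : m ^ 2 / 4 ≤ (FF x (B * s) Λ - m) ^ 2 := by nlinarith
      have h5 : 1 ≤ 4 / m ^ 2 * (FF x (B * s) Λ - m) ^ 2 := by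
        calc (1 : ℝ) = 4 / m ^ 2 * (m ^ 2 / 4) := by field_simp
          _ ≤ _ := by gcongr
      have h6 : (0 : ℝ) ≤ Λ.rowLen r := by positivity
      nlinarith
    · have : 0 ≤ (x * (4 / m ^ 2)) * (FF x (B * s) Λ - m) ^ 2 := by positivity
      linarith
  rw [Ex_add N (fun _ => x) (fun Λ => (-(x * (4 / m ^ 2))) * (FF x (B * s) Λ - m) ^ 2),
    Ex_const, Ex_smul] at key
  have h7 : 4 / m ^ 2 * N ≤ ε := by
    have b1 : (η * N) ^ 2 ≤ m ^ 2 := by gcongr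
    rw [div_le_iff₀ (by positivity)] at hN2
    rw [div_mul_eq_mul_div, div_le_iff₀ (by positivity)]
    calc 4 * (N : ℝ) ≤ (N * (η ^ 2 * ε)) * N := by gcongr
      _ = ε * (η * N) ^ 2 := by ring
      _ ≤ ε * m ^ 2 := by gcongr
  have h8 : x * (4 / m ^ 2) * Ex N (fun Λ => (FF x (B * s) Λ - m) ^ 2) ≤ x * ε := by
    calc _ ≤ x * (4 / m ^ 2) * N := by gcongr
      _ = x * (4 / m ^ 2 * N) := by ring
      _ ≤ x * ε := by gcongr
  linarith

theorem row_upper_sum (r n : ℕ) : Ex n (fun Λ => (Λ.rowLen r : ℝ)) ≤ 2 * Real.sqrt n := by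
  induction n with
  | zero =>
    have hb : (⊥ : YoungDiagram).rowLen r = 0 := by
      by_contra h
      have : (r, 0) ∈ (⊥ : YoungDiagram) := YoungDiagram.mem_iff_lt_rowLen.2 (by omega)
      simp at this
    rw [Ex_telescope]
    simp [hb]
  | succ n ih =>
    rw [Ex_succ]
    have h1 := row_upper n r
    have h2 : 1 / Real.sqrt (n + 1) ≤ 2 * (Real.sqrt (n + 1) - Real.sqrt n) := by
      have ha : 0 < Real.sqrt ((n : ℝ) + 1) := Real.sqrt_pos.2 (by positivity)
      have hb := Real.sqrt_nonneg (n : ℝ)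
      have hc := Real.sq_sqrt (show (0 : ℝ) ≤ (n : ℝ) + 1 by positivity)
      have hd := Real.sq_sqrt (show (0 : ℝ) ≤ (n : ℝ) by positivity)
      rw [div_le_iff₀ ha]
      nlinarith [sq_nonneg (Real.sqrt ((n : ℝ) + 1) - Real.sqrt n)]
    push_cast
    linarith

theorem main_aux {Ω : Type*} [MeasurableSpace Ω] (P : Measure Ω)
    (lam : ℕ → Ω → YoungDiagram) (hPGP : IsPlancherelGrowthProcess P lam) (K : ℕ) :
    2 * (K + 1 : ℝ) ≤
      Filter.liminf
        (fun n : ℕ =>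
          (∑ m ∈ Finset.range n,
            ∑ r ∈ Finset.range (K + 1), (P (growthEvent lam m r)).toReal) / Real.sqrt n)
        Filter.atTop := by
  simp only [sum_growth P lam hPGP]
  have hcob : IsCoboundedUnder (· ≥ ·) atTop
      (fun n : ℕ => (∑ r ∈ range (K + 1), Ex n (fun Λ => (Λ.rowLen r : ℝ))) / Real.sqrt n) := by
    apply IsBoundedUnder.isCoboundedUnder_ge
    refine isBoundedUnder_of ⟨2 * (K + 1), fun n => ?_⟩
    apply div_le_of_le_mul₀ (Real.sqrt_nonneg _) (by positivity)
    calc _ ≤ ∑ r ∈ range (K + 1), 2 * Real.sqrt n := sum_le_sum fun r _ => row_upper_sum r n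
      _ = _ := by rw [sum_const, card_range, nsmul_eq_mul]; push_cast; ring
  have key : ∀ ε : ℝ, 0 < ε → ε < 1 → (K + 1) * ((2 - ε) * (1 - ε) * (1 - ε)) ≤ liminf
      (fun n : ℕ => (∑ r ∈ range (K + 1), Ex n (fun Λ => (Λ.rowLen r : ℝ))) / Real.sqrt n) atTop := by
    intro ε h0 h1
    apply le_liminf_of_le hcob
    have : ∀ᶠ N : ℕ in atTop, ∀ r ∈ range (K + 1), (2 - ε) * (1 - ε) * (1 - ε) * Real.sqrt N ≤
        Ex N (fun Λ => (Λ.rowLen r : ℝ)) :=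
      (Filter.eventually_all_finset _).2 fun r _ => row_lower r h0 h1
    filter_upwards [this, eventually_ge_atTop 1] with N hN hN1
    have hs : 0 < Real.sqrt N := Real.sqrt_pos.2 (by exact_mod_cast hN1)
    rw [le_div_iff₀ hs]
    refine le_trans (le_of_eq ?_) (sum_le_sum hN)
    rw [sum_const, card_range, nsmul_eq_mul]; push_cast; ring
  have hlim : Tendsto (fun ε : ℝ => (K + 1 : ℝ) * ((2 - ε) * (1 - ε) * (1 - ε)))
      (nhdsWithin 0 (Set.Ioi 0)) (nhds ((K + 1 : ℝ) * ((2 - 0) * (1 - 0) * (1 - 0)))) := by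
    apply tendsto_nhdsWithin_of_tendsto_nhds
    apply Continuous.tendsto (f := fun ε : ℝ => (K + 1 : ℝ) * ((2 - ε) * (1 - ε) * (1 - ε)))
    fun_prop
  have e : 2 * (K + 1 : ℝ) = (K + 1 : ℝ) * ((2 - 0) * (1 - 0) * (1 - 0)) := by ring
  rw [e]
  refine le_of_tendsto hlim ?_
  filter_upwards [Ioo_mem_nhdsGT (show (0 : ℝ) < 1 by norm_num)] with ε hε
  exact key ε hε.1 hε.2

end PlancherelProof

/-- Fix `K ≥ 0` and let `s_n = ∑_{0 ≤ r ≤ K} ℙ(E_r⁽ⁿ⁾)` for `n ≥ 1`.  Then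
`liminf_{n→∞} (s_1 + ⋯ + s_n)/√n ≥ 2(K+1)`.  (With our indexing,
`s_{m+1} = ∑_{r ≤ K} ℙ(growthEvent lam m r)`, so `s_1 + ⋯ + s_n = ∑_{m ∈ range n} s_{m+1}`.) -/
theorem liminf_partial_sums_growth_prob {Ω : Type*} [MeasurableSpace Ω] (P : Measure Ω)
    (lam : ℕ → Ω → YoungDiagram) (hPGP : IsPlancherelGrowthProcess P lam) (K : ℕ) :
    2 * (K + 1 : ℝ) ≤
      Filter.liminf
        (fun n : ℕ =>
          (∑ m ∈ Finset.range n,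
            ∑ r ∈ Finset.range (K + 1), (P (growthEvent lam m r)).toReal) / Real.sqrt n)
        Filter.atTop := by
  exact main_aux P lam hPGP K
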